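/- The value ξ₀* := inf{ r ∈ ℝ : every ξ₀ > r is of type 1 } is both of type 1 and of type 2: there exists T₁ > 0 with θ_{ξ₀*}(T₁) = θ* and ξ'_{ξ₀*}(t) ≠ 0 for all t ∈ (0, T₁), and there exists T₂ > 0 with ξ'_{ξ₀*}(T₂) = 0 and θ_{ξ₀*}(t) ≠ θ* for all t ∈ (0, T₂). -/

import Mathlib

/-- The constant `m = m₁ + m₂ + 2/g`. -/
noncomputable def mconst (g m₁ m₂ : ℕ) : ℝ := (m₁ : ℝ) + (m₂ : ℝ) + 2 / (g : ℝ)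

/-- The angle `θ* = arctan √(m₁/m₂)`. -/
noncomputable def thetaStar (m₁ m₂ : ℕ) : ℝ :=
  Real.arctan (Real.sqrt ((m₁ : ℝ) / (m₂ : ℝ)))

/-- `l(θ) = m₁ cos² θ - m₂ sin² θ`. -/
noncomputable def lfun (m₁ m₂ : ℕ) (θ : ℝ) : ℝ :=
  (m₁ : ℝ) * Real.cos θ ^ 2 - (m₂ : ℝ) * Real.sin θ ^ 2

/-- `(ξ, θ, α)` is a (globally defined) solution of the ODE system (*):
`ξ' = cos α · sin 2θ`, `θ' = sin α · sin 2θ`,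
`α' = sin α · sin 2θ · (exp((4/g)ξ) - m) + 2 cos α · l(θ)`. -/
def IsSolution (g m₁ m₂ : ℕ) (ξ θ α : ℝ → ℝ) : Prop :=
  ∀ t : ℝ,
    HasDerivAt ξ (Real.cos (α t) * Real.sin (2 * θ t)) t ∧
    HasDerivAt θ (Real.sin (α t) * Real.sin (2 * θ t)) t ∧
    HasDerivAt α
      (Real.sin (α t) * Real.sin (2 * θ t) *
          (Real.exp (4 / (g : ℝ) * ξ t) - mconst g m₁ m₂) +
        2 * Real.cos (α t) * lfun m₁ m₂ (θ t)) t

/-- `Ξ Θ A` is the family of solutions of (*) indexed by the initial value `ξ₀`,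
with initial condition `(ξ, θ, α)(0) = (ξ₀, θ*, π/2)`. -/
def IsShootingFamily (g m₁ m₂ : ℕ) (Ξ Θ A : ℝ → ℝ → ℝ) : Prop :=
  ∀ ξ₀ : ℝ, IsSolution g m₁ m₂ (Ξ ξ₀) (Θ ξ₀) (A ξ₀) ∧
    Ξ ξ₀ 0 = ξ₀ ∧ Θ ξ₀ 0 = thetaStar m₁ m₂ ∧ A ξ₀ 0 = Real.pi / 2

/-- `ξ₀` is of type 1: there is `T > 0` with `θ_{ξ₀}(T) = θ*` and
`ξ'_{ξ₀}(t) ≠ 0` for all `t ∈ (0, T)`. -/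
def Type1 (m₁ m₂ : ℕ) (Ξ Θ A : ℝ → ℝ → ℝ) (ξ₀ : ℝ) : Prop :=
  ∃ T > (0 : ℝ), Θ ξ₀ T = thetaStar m₁ m₂ ∧
    ∀ t ∈ Set.Ioo (0 : ℝ) T, Real.cos (A ξ₀ t) * Real.sin (2 * Θ ξ₀ t) ≠ 0

/-- `ξ₀` is of type 2: there is `T > 0` with `ξ'_{ξ₀}(T) = 0` and
`θ_{ξ₀}(t) ≠ θ*` for all `t ∈ (0, T)`. -/
def Type2 (m₁ m₂ : ℕ) (Ξ Θ A : ℝ → ℝ → ℝ) (ξ₀ : ℝ) : Prop :=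
  ∃ T > (0 : ℝ), Real.cos (A ξ₀ T) * Real.sin (2 * Θ ξ₀ T) = 0 ∧
    ∀ t ∈ Set.Ioo (0 : ℝ) T, Θ ξ₀ t ≠ thetaStar m₁ m₂

/-- `ξ₀* = inf { r : every ξ₀ > r is of type 1 }`. -/
noncomputable def xiStar (m₁ m₂ : ℕ) (Ξ Θ A : ℝ → ℝ → ℝ) : ℝ :=
  sInf {r : ℝ | ∀ ξ₀ > r, Type1 m₁ m₂ Ξ Θ A ξ₀}

section

open Set Filter Topology

/-! ### One-variable calculus -/

lemma le_of_hasDerivAt_nonneg {f f' : ℝ → ℝ} (hf : ∀ t, HasDerivAt f (f' t) t) {a b : ℝ}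
    (hab : a ≤ b) (h : ∀ t ∈ Ioo a b, 0 ≤ f' t) : f a ≤ f b := by
  refine monotoneOn_of_deriv_nonneg (convex_Icc a b)
    (fun t _ => (hf t).continuousAt.continuousWithinAt)
    (fun t _ => (hf t).differentiableAt.differentiableWithinAt) (fun t ht => ?_)
    (left_mem_Icc.2 hab) (right_mem_Icc.2 hab) hab
  rw [interior_Icc] at ht
  rw [(hf t).deriv]
  exact h t ht

lemma lt_of_hasDerivAt_pos_of_eq {f f' : ℝ → ℝ} (hf : ∀ t, HasDerivAt f (f' t) t) {a b c : ℝ}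
    (ha : c ≤ f a) (h : ∀ t ∈ Icc a b, f t = c → 0 < f' t) {t : ℝ} (ht : t ∈ Ioc a b) :
    c < f t := by
  have key : ∀ ⦃x⦄, x ∈ Icc a b → -f x ≤ -c :=
    image_le_of_deriv_right_lt_deriv_boundary' (f := fun x => -f x) (f' := fun x => -f' x)
      (B' := fun _ => 0) (fun x _ => (hf x).neg.continuousAt.continuousWithinAt)
      (fun x _ => (hf x).neg.hasDerivWithinAt) (by linarith) continuousOn_const
      (fun x _ => hasDerivWithinAt_const _ _ _)
      (fun x hx hxc => by linarith [h x (Ico_subset_Icc_self hx) (by linarith)])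
  have hct : c ≤ f t := by linarith [key (Ioc_subset_Icc_self ht)]
  refine lt_of_le_of_ne hct fun hEq => ?_
  have hpos := h t (Ioc_subset_Icc_self ht) hEq.symm
  have hev : ∀ᶠ x in 𝓝[<] t, 0 < slope f t x :=
    ((hasDerivAt_iff_tendsto_slope.1 (hf t)).mono_left
      (nhdsWithin_mono _ fun x hx => ne_of_lt hx)).eventually (lt_mem_nhds hpos)
  obtain ⟨x, hx, hxa, hxt⟩ := (hev.and (Ioo_mem_nhdsLT ht.1)).exists
  have hcx : c ≤ f x := by linarith [key ⟨hxa.le, hxt.le.trans ht.2⟩]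
  rw [slope_def_field] at hx
  have := (div_nonpos_of_nonneg_of_nonpos (sub_nonneg.2 (hEq ▸ hcx)) (sub_nonpos.2 hxt.le))
  linarith

/-! ### Uniqueness and continuous dependence -/

/-- The vector field of the system. -/
noncomputable def shootField (g m₁ m₂ : ℕ) (p : ℝ × ℝ × ℝ) : ℝ × ℝ × ℝ :=
  (Real.cos p.2.2 * Real.sin (2 * p.2.1), Real.sin p.2.2 * Real.sin (2 * p.2.1),
    Real.sin p.2.2 * Real.sin (2 * p.2.1) * (Real.exp (4 / (g : ℝ) * p.1) - mconst g m₁ m₂) +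
      2 * Real.cos p.2.2 * lfun m₁ m₂ p.2.1)

lemma contDiff_shootField (g m₁ m₂ : ℕ) : ContDiff ℝ 1 (shootField g m₁ m₂) := by
  unfold shootField lfun
  fun_prop

lemma IsCompact.exists_lipschitzOnWith_shootField (g m₁ m₂ : ℕ) {s : Set (ℝ × ℝ × ℝ)}
    (hs : IsCompact s) : ∃ K, LipschitzOnWith K (shootField g m₁ m₂) s :=
  (contDiff_shootField g m₁ m₂).locallyLipschitz.locallyLipschitzOn.exists_lipschitzOnWith_of_compact
    hs

namespace IsSolution

variable {g m₁ m₂ : ℕ} {ξ θ α ξ' θ' α' : ℝ → ℝ}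

lemma hasDerivAt_prod (h : IsSolution g m₁ m₂ ξ θ α) (t : ℝ) :
    HasDerivAt (fun t => (ξ t, θ t, α t)) (shootField g m₁ m₂ (ξ t, θ t, α t)) t :=
  (h t).1.prodMk ((h t).2.1.prodMk (h t).2.2)

lemma continuous_prod (h : IsSolution g m₁ m₂ ξ θ α) :
    Continuous fun t => (ξ t, θ t, α t) :=
  continuous_iff_continuousAt.2 fun t => (h.hasDerivAt_prod t).continuousAt

lemma continuous_snd (h : IsSolution g m₁ m₂ ξ θ α) : Continuous θ :=
  continuous_iff_continuousAt.2 fun t => (h t).2.1.continuousAt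

lemma continuous_thd (h : IsSolution g m₁ m₂ ξ θ α) : Continuous α :=
  continuous_iff_continuousAt.2 fun t => (h t).2.2.continuousAt

lemma unique (h : IsSolution g m₁ m₂ ξ θ α) (h' : IsSolution g m₁ m₂ ξ' θ' α') {t₀ : ℝ}
    (h₁ : ξ t₀ = ξ' t₀) (h₂ : θ t₀ = θ' t₀) (h₃ : α t₀ = α' t₀) (t : ℝ) :
    ξ t = ξ' t ∧ θ t = θ' t ∧ α t = α' t := by
  obtain ⟨a, b, ht, ht₀⟩ : ∃ a b, t ∈ Ioo a b ∧ t₀ ∈ Ioo a b :=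
    ⟨min t t₀ - 1, max t t₀ + 1, by grind, by grind⟩
  obtain ⟨K, hK⟩ := (((isCompact_Icc (a := a) (b := b)).image h.continuous_prod).union
    ((isCompact_Icc (a := a) (b := b)).image
      h'.continuous_prod)).exists_lipschitzOnWith_shootField g m₁ m₂
  have := ODE_solution_unique_of_mem_Ioo (v := fun _ => shootField g m₁ m₂) (fun _ _ => hK) ht₀
    (fun s hs => ⟨h.hasDerivAt_prod s, Or.inl (mem_image_of_mem _ (Ioo_subset_Icc_self hs))⟩)
    (fun s hs => ⟨h'.hasDerivAt_prod s, Or.inr (mem_image_of_mem _ (Ioo_subset_Icc_self hs))⟩)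
    (by simp [h₁, h₂, h₃]) ht
  simpa using this

lemma abs_fst_deriv_le (θ α : ℝ → ℝ) (t : ℝ) :
    |Real.cos (α t) * Real.sin (2 * θ t)| ≤ 1 := by
  rw [abs_mul]
  exact mul_le_one₀ (Real.abs_cos_le_one _) (abs_nonneg _) (Real.abs_sin_le_one _)

lemma abs_snd_deriv_le (θ α : ℝ → ℝ) (t : ℝ) :
    |Real.sin (α t) * Real.sin (2 * θ t)| ≤ 1 := by
  rw [abs_mul]
  exact mul_le_one₀ (Real.abs_sin_le_one _) (abs_nonneg _) (Real.abs_sin_le_one _)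

lemma abs_lfun_le (m₁ m₂ : ℕ) (x : ℝ) : |lfun m₁ m₂ x| ≤ m₁ + m₂ := by
  have h1 : (0 : ℝ) ≤ m₁ := m₁.cast_nonneg
  have h2 : (0 : ℝ) ≤ m₂ := m₂.cast_nonneg
  have := Real.sin_sq_add_cos_sq x
  rw [lfun, abs_le]
  constructor <;> nlinarith [sq_nonneg (Real.sin x), sq_nonneg (Real.cos x)]

lemma abs_sub_le_of_bound {f f' : ℝ → ℝ} (hf : ∀ t, HasDerivAt f (f' t) t) {C a b : ℝ}
    (hab : a ≤ b) (h : ∀ t ∈ Icc a b, |f' t| ≤ C) : |f b - f a| ≤ C * (b - a) := by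
  have := (convex_Icc a b).norm_image_sub_le_of_norm_hasDerivWithin_le
    (fun t _ => (hf t).hasDerivWithinAt) h (left_mem_Icc.2 hab) (right_mem_Icc.2 hab)
  simpa [abs_of_nonneg (sub_nonneg.2 hab)] using this

lemma abs_thd_deriv_le {E : ℝ} {t : ℝ}
    (hE : Real.exp (4 / (g : ℝ) * ξ t) ≤ E) :
    |Real.sin (α t) * Real.sin (2 * θ t) *
          (Real.exp (4 / (g : ℝ) * ξ t) - mconst g m₁ m₂) +
        2 * Real.cos (α t) * lfun m₁ m₂ (θ t)| ≤ E + mconst g m₁ m₂ + 2 * (m₁ + m₂) := by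
  have hm : 0 ≤ mconst g m₁ m₂ := by unfold mconst; positivity
  have h1 : |Real.exp (4 / (g : ℝ) * ξ t) - mconst g m₁ m₂| ≤ E + mconst g m₁ m₂ := by
    rw [abs_le]; constructor <;> linarith [Real.exp_pos (4 / (g : ℝ) * ξ t)]
  refine (abs_add_le _ _).trans (add_le_add ?_ ?_)
  · rw [abs_mul]
    calc _ ≤ 1 * (E + mconst g m₁ m₂) :=
          mul_le_mul (abs_snd_deriv_le θ α t) h1 (abs_nonneg _) zero_le_one
      _ = _ := one_mul _
  · rw [abs_mul, abs_mul, abs_two, mul_assoc]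
    calc 2 * (|Real.cos (α t)| * |lfun m₁ m₂ (θ t)|) ≤ 2 * (1 * (m₁ + m₂)) := by
          have h2 := abs_lfun_le m₁ m₂ (θ t)
          have := mul_le_mul (Real.abs_cos_le_one (α t)) h2 (abs_nonneg _) zero_le_one
          linarith
      _ = _ := by ring

/-- A solution whose initial value lies in a ball stays in a ball for a bounded time. -/
lemma exists_bound (g m₁ m₂ : ℕ) (R T : ℝ) : ∃ S, ∀ ξ θ α : ℝ → ℝ, IsSolution g m₁ m₂ ξ θ α →
    (ξ 0, θ 0, α 0) ∈ Metric.closedBall 0 R →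
    ∀ t ∈ Icc 0 T, (ξ t, θ t, α t) ∈ Metric.closedBall 0 S := by
  set C := Real.exp (4 / (g : ℝ) * (R + T)) + mconst g m₁ m₂ + 2 * (m₁ + m₂) with hC
  have hm : 0 ≤ mconst g m₁ m₂ := by unfold mconst; positivity
  have hC0 : 0 ≤ C := by positivity
  refine ⟨R + (1 + C) * T, fun ξ θ α h h0 t ht => ?_⟩
  simp only [mem_closedBall_zero_iff, Prod.norm_def, Real.norm_eq_abs, sup_le_iff] at h0 ⊢
  have hx : ∀ s ∈ Icc 0 t, |ξ s - ξ 0| ≤ 1 * (s - 0) := fun s hs =>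
    abs_sub_le_of_bound (fun r => (h r).1) hs.1 fun r _ => abs_fst_deriv_le θ α r
  have hth : |θ t - θ 0| ≤ 1 * (t - 0) :=
    abs_sub_le_of_bound (fun r => (h r).2.1) ht.1 fun r _ => abs_snd_deriv_le θ α r
  have hal : |α t - α 0| ≤ C * (t - 0) := by
    refine abs_sub_le_of_bound (fun r => (h r).2.2) ht.1 fun r hr => abs_thd_deriv_le ?_
    refine Real.exp_le_exp.2 (mul_le_mul_of_nonneg_left ?_ (by positivity))
    linarith [abs_le.1 (hx r hr), abs_le.1 h0.1, hr.2, ht.2]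
  have hxt := hx t ⟨ht.1, le_rfl⟩
  have h1 : 0 ≤ C * (T - t) := mul_nonneg hC0 (sub_nonneg.2 ht.2)
  have h2 : 0 ≤ C * t := mul_nonneg hC0 ht.1
  have ht2 := ht.2
  have ht1 := ht.1
  rw [abs_le] at hxt hth hal
  refine ⟨abs_le.2 ⟨?_, ?_⟩, abs_le.2 ⟨?_, ?_⟩, abs_le.2 ⟨?_, ?_⟩⟩ <;>
    nlinarith [abs_le.1 h0.1, abs_le.1 h0.2.1, abs_le.1 h0.2.2]

end IsSolution

lemma IsShootingFamily.continuous_dependence {g m₁ m₂ : ℕ} {Ξ Θ A : ℝ → ℝ → ℝ}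
    (h : IsShootingFamily g m₁ m₂ Ξ Θ A) (x₀ T : ℝ) {ε : ℝ} (hε : 0 < ε) :
    ∀ᶠ x in 𝓝 x₀, ∀ t ∈ Icc 0 T, |Θ x t - Θ x₀ t| < ε ∧ |A x t - A x₀ t| < ε := by
  obtain ⟨S, hS⟩ := IsSolution.exists_bound g m₁ m₂ (|x₀| + 1 + |thetaStar m₁ m₂| + Real.pi) T
  obtain ⟨K, hK⟩ :=
    (isCompact_closedBall (0 : ℝ × ℝ × ℝ) S).exists_lipschitzOnWith_shootField g m₁ m₂
  have hS' : ∀ x, |x - x₀| < 1 → ∀ t ∈ Icc 0 T,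
      (Ξ x t, Θ x t, A x t) ∈ Metric.closedBall (0 : ℝ × ℝ × ℝ) S := by
    intro x hx
    refine hS _ _ _ (h x).1 ?_
    obtain ⟨-, h1, h2, h3⟩ := h x
    have hpi := Real.pi_pos
    have hx' : |x| ≤ |x₀| + 1 := by
      have := abs_sub_abs_le_abs_sub x x₀
      linarith
    simp only [mem_closedBall_zero_iff, Prod.norm_def, Real.norm_eq_abs, sup_le_iff, h1, h2, h3,
      abs_of_pos (half_pos hpi)]
    refine ⟨?_, ?_, ?_⟩ <;> linarith [abs_nonneg x₀, abs_nonneg (thetaStar m₁ m₂)]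
  have hlim : Tendsto (fun x => |x - x₀| * Real.exp (K * T)) (𝓝 x₀) (𝓝 0) :=
    Continuous.tendsto' (by fun_prop) _ _ (by simp)
  have hlim' : Tendsto (fun x => |x - x₀|) (𝓝 x₀) (𝓝 0) :=
    Continuous.tendsto' (by fun_prop) _ _ (by simp)
  filter_upwards [hlim.eventually (gt_mem_nhds hε), hlim'.eventually (gt_mem_nhds one_pos)]
    with x hx hx1 t ht
  have key := dist_le_of_trajectories_ODE_of_mem (v := fun _ => shootField g m₁ m₂)
    (s := fun _ => Metric.closedBall (0 : ℝ × ℝ × ℝ) S) (K := K) (δ := |x - x₀|) (a := 0) (b := T)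
    (fun _ _ => hK) (h x).1.continuous_prod.continuousOn
    (fun t _ => ((h x).1.hasDerivAt_prod t).hasDerivWithinAt)
    (fun t ht => hS' x hx1 t (Ico_subset_Icc_self ht))
    (h x₀).1.continuous_prod.continuousOn
    (fun t _ => ((h x₀).1.hasDerivAt_prod t).hasDerivWithinAt)
    (fun t ht => hS' x₀ (by simp) t (Ico_subset_Icc_self ht))
    (by
      obtain ⟨-, h1, h2, h3⟩ := h x
      obtain ⟨-, h1', h2', h3'⟩ := h x₀
      simp [Prod.dist_eq, h1, h2, h3, h1', h2', h3', Real.dist_eq]) t ht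
  have hlt : |x - x₀| * Real.exp (K * (t - 0)) < ε := by
    refine lt_of_le_of_lt ?_ hx
    gcongr
    linarith [ht.2]
  have := key.trans_lt hlt
  simp only [Prod.dist_eq, Real.dist_eq, sup_lt_iff] at this
  exact this.2

/-! ### The angle `θ*` and the weight `sin ^ m₁ * cos ^ m₂` -/

lemma thetaStar_pos {m₁ m₂ : ℕ} (hm₁ : 0 < m₁) (hm₂ : 0 < m₂) : 0 < thetaStar m₁ m₂ :=
  Real.arctan_pos.2 (Real.sqrt_pos.2 (by positivity))

lemma thetaStar_lt (m₁ m₂ : ℕ) : thetaStar m₁ m₂ < Real.pi / 2 := Real.arctan_lt_pi_div_two _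

lemma mconst_pos {g : ℕ} (hg : 0 < g) (m₁ m₂ : ℕ) : 0 < mconst g m₁ m₂ := by
  unfold mconst; positivity

lemma lfun_eq (m₁ m₂ : ℕ) (x : ℝ) : lfun m₁ m₂ x = (m₁ + m₂) * Real.cos x ^ 2 - m₂ := by
  rw [lfun, Real.sin_sq]; ring

lemma lfun_thetaStar (m₁ : ℕ) {m₂ : ℕ} (hm₂ : 0 < m₂) : lfun m₁ m₂ (thetaStar m₁ m₂) = 0 := by
  have h2 : (0 : ℝ) < m₂ := by exact_mod_cast hm₂
  have h1 : (0 : ℝ) ≤ m₁ := m₁.cast_nonneg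
  rw [lfun_eq, thetaStar, Real.cos_sq_arctan, Real.sq_sqrt (by positivity)]
  field_simp
  ring

lemma lfun_lt_of_lt {m₁ m₂ : ℕ} (hm₂ : 0 < m₂) {x y : ℝ} (hx : 0 ≤ x) (hxy : x < y)
    (hy : y ≤ Real.pi / 2) : lfun m₁ m₂ y < lfun m₁ m₂ x := by
  have h2 : (0 : ℝ) < m₂ := by exact_mod_cast hm₂
  have h1 : (0 : ℝ) ≤ m₁ := m₁.cast_nonneg
  have hc := Real.cos_lt_cos_of_nonneg_of_le_pi_div_two hx hy hxy
  have hc0 : 0 ≤ Real.cos y := Real.cos_nonneg_of_neg_pi_div_two_le_of_le (by linarith) hy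
  rw [lfun_eq, lfun_eq]
  nlinarith [mul_pos (add_pos_of_nonneg_of_pos h1 h2) (sub_pos.2 hc)]

lemma lfun_neg {m₁ m₂ : ℕ} (hm₁ : 0 < m₁) (hm₂ : 0 < m₂) {x : ℝ} (hx : thetaStar m₁ m₂ < x)
    (hx' : x < Real.pi / 2) : lfun m₁ m₂ x < 0 :=
  (lfun_lt_of_lt hm₂ (thetaStar_pos hm₁ hm₂).le hx hx'.le).trans_eq (lfun_thetaStar m₁ hm₂)

/-- The weight `sin ^ m₁ * cos ^ m₂`. -/
noncomputable def sincosWeight (m₁ m₂ : ℕ) (x : ℝ) : ℝ := Real.sin x ^ m₁ * Real.cos x ^ m₂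

lemma sin_cos_pos {x : ℝ} (hx : x ∈ Ioo 0 (Real.pi / 2)) : 0 < Real.sin x ∧ 0 < Real.cos x :=
  ⟨Real.sin_pos_of_pos_of_lt_pi hx.1 (by linarith [hx.2, Real.pi_pos]),
    Real.cos_pos_of_mem_Ioo ⟨by linarith [hx.1, Real.pi_pos], hx.2⟩⟩

lemma sin_two_mul_pos {x : ℝ} (hx : x ∈ Ioo 0 (Real.pi / 2)) : 0 < Real.sin (2 * x) := by
  obtain ⟨h1, h2⟩ := sin_cos_pos hx
  rw [Real.sin_two_mul]
  positivity

lemma sincosWeight_pos (m₁ m₂ : ℕ) {x : ℝ} (hx : x ∈ Ioo 0 (Real.pi / 2)) :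
    0 < sincosWeight m₁ m₂ x :=
  mul_pos (pow_pos (sin_cos_pos hx).1 _) (pow_pos (sin_cos_pos hx).2 _)

lemma sincosWeight_le_cos (m₁ : ℕ) {m₂ : ℕ} (hm₂ : 0 < m₂) {x : ℝ}
    (hx : x ∈ Ioo 0 (Real.pi / 2)) : sincosWeight m₁ m₂ x ≤ Real.cos x := by
  have h := sin_cos_pos hx
  have h1 : Real.sin x ^ m₁ ≤ 1 := pow_le_one₀ h.1.le (Real.sin_le_one x)
  have h2 : Real.cos x ^ m₂ ≤ Real.cos x :=
    pow_le_of_le_one h.2.le (Real.cos_le_one x) hm₂.ne'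
  calc sincosWeight m₁ m₂ x ≤ 1 * Real.cos x :=
        mul_le_mul h1 h2 (pow_nonneg h.2.le _) zero_le_one
    _ = _ := one_mul _

lemma hasDerivAt_sincosWeight (m₁ m₂ : ℕ) {f : ℝ → ℝ} {a t : ℝ}
    (hf : HasDerivAt f (a * Real.sin (2 * f t)) t) :
    HasDerivAt (fun t => sincosWeight m₁ m₂ (f t))
      (2 * a * sincosWeight m₁ m₂ (f t) * lfun m₁ m₂ (f t)) t := by
  have h := (hf.sin.pow m₁).mul (hf.cos.pow m₂)
  refine h.congr_deriv ?_
  simp only [sincosWeight, lfun, Real.sin_two_mul]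
  rcases m₁ with _ | m₁ <;> rcases m₂ with _ | m₂ <;> simp <;> ring

/-! ### A single solution -/

/-- `(ξ, θ, α)` is a solution starting from `θ = θ*`, `α = π/2`. -/
structure Shot (g m₁ m₂ : ℕ) (ξ θ α : ℝ → ℝ) : Prop where
  g_pos : 0 < g
  m₁_pos : 0 < m₁
  m₂_pos : 0 < m₂
  sol : IsSolution g m₁ m₂ ξ θ α
  theta_zero : θ 0 = thetaStar m₁ m₂
  alpha_zero : α 0 = Real.pi / 2

/-- The quantity `-cos α * sin ^ m₁ θ * cos ^ m₂ θ`, whose derivative has the sign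
of `exp((4/g)ξ) - m`. -/
noncomputable def flux (m₁ m₂ : ℕ) (θ α : ℝ → ℝ) (t : ℝ) : ℝ :=
  -Real.cos (α t) * sincosWeight m₁ m₂ (θ t)

/-- The exponential `exp((4/g)ξ)`. -/
noncomputable def expXi (g : ℕ) (ξ : ℝ → ℝ) (t : ℝ) : ℝ := Real.exp (4 / (g : ℝ) * ξ t)

lemma expXi_pos (g : ℕ) (ξ : ℝ → ℝ) (t : ℝ) : 0 < expXi g ξ t := Real.exp_pos _

namespace Shot

variable {g m₁ m₂ : ℕ} {ξ θ α : ℝ → ℝ}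

lemma theta_ne (h : Shot g m₁ m₂ ξ θ α) {c : ℝ} (hc : Real.sin (2 * c) = 0)
    (hc' : thetaStar m₁ m₂ ≠ c) (t : ℝ) : θ t ≠ c := by
  intro hEq
  have hlip : ∀ t, LipschitzOnWith 2 (fun x => Real.sin (α t) * Real.sin (2 * x)) univ := by
    intro t
    refine LipschitzOnWith.of_dist_le_mul fun x _ y _ => ?_
    rw [Real.dist_eq, Real.dist_eq, ← mul_sub, abs_mul]
    have h1 : |Real.sin (2 * x) - Real.sin (2 * y)| ≤ |2 * x - 2 * y| :=
      Real.abs_sin_sub_sin_le _ _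
    rw [← mul_sub, abs_mul, abs_two] at h1
    calc _ ≤ 1 * (2 * |x - y|) :=
          mul_le_mul (Real.abs_sin_le_one _) h1 (abs_nonneg _) zero_le_one
      _ = _ := by simp
  have := ODE_solution_unique_univ (v := fun t x => Real.sin (α t) * Real.sin (2 * x))
    (f := θ) (g := fun _ => c) (t₀ := t) hlip (fun s => ⟨(h.sol s).2.1, mem_univ _⟩)
    (fun s => ⟨by simpa [hc] using hasDerivAt_const s c, mem_univ _⟩) hEq
  exact hc' (h.theta_zero ▸ congrFun this 0)

lemma theta_mem (h : Shot g m₁ m₂ ξ θ α) (t : ℝ) : θ t ∈ Ioo 0 (Real.pi / 2) := by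
  have h0 := thetaStar_pos h.m₁_pos h.m₂_pos
  have h1 := thetaStar_lt m₁ m₂
  have ne0 := h.theta_ne (c := 0) (by simp) h0.ne'
  have ne1 := h.theta_ne (c := Real.pi / 2) (by rw [mul_div_cancel₀ _ two_ne_zero]; simp) h1.ne
  have hc := h.sol.continuous_snd
  have hz := h.theta_zero
  constructor
  · by_contra! hle
    obtain ⟨s, hs⟩ := mem_range_of_exists_le_of_exists_ge hc ⟨t, hle⟩ ⟨0, hz ▸ h0.le⟩
    exact ne0 s hs
  · by_contra! hle
    obtain ⟨s, hs⟩ := mem_range_of_exists_le_of_exists_ge hc ⟨0, hz ▸ h1.le⟩ ⟨t, hle⟩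
    exact ne1 s hs

lemma sin_two_pos (h : Shot g m₁ m₂ ξ θ α) (t : ℝ) : 0 < Real.sin (2 * θ t) :=
  sin_two_mul_pos (h.theta_mem t)

lemma weight_pos (h : Shot g m₁ m₂ ξ θ α) (t : ℝ) : 0 < sincosWeight m₁ m₂ (θ t) :=
  sincosWeight_pos m₁ m₂ (h.theta_mem t)

lemma weight_le_one (h : Shot g m₁ m₂ ξ θ α) (t : ℝ) : sincosWeight m₁ m₂ (θ t) ≤ 1 :=
  (sincosWeight_le_cos m₁ h.m₂_pos (h.theta_mem t)).trans (Real.cos_le_one _)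

lemma hasDerivAt_flux (h : Shot g m₁ m₂ ξ θ α) (t : ℝ) :
    HasDerivAt (flux m₁ m₂ θ α) (Real.sin (α t) ^ 2 * Real.sin (2 * θ t) *
      sincosWeight m₁ m₂ (θ t) * (expXi g ξ t - mconst g m₁ m₂)) t := by
  have h1 := ((h.sol t).2.2.cos.fun_neg).fun_mul
    (hasDerivAt_sincosWeight m₁ m₂ (h.sol t).2.1)
  refine h1.congr_deriv ?_
  simp only [expXi]
  ring

lemma hasDerivAt_expXi (h : Shot g m₁ m₂ ξ θ α) (t : ℝ) :
    HasDerivAt (expXi g ξ) (4 / (g : ℝ) * (Real.cos (α t) * Real.sin (2 * θ t)) *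
      expXi g ξ t) t := by
  refine ((h.sol t).1.const_mul (4 / (g : ℝ))).exp.congr_deriv ?_
  simp only [expXi]
  ring

lemma flux_zero (h : Shot g m₁ m₂ ξ θ α) : flux m₁ m₂ θ α 0 = 0 := by
  simp [flux, h.alpha_zero]

lemma continuous_flux (h : Shot g m₁ m₂ ξ θ α) : Continuous (flux m₁ m₂ θ α) :=
  continuous_iff_continuousAt.2 fun t => (h.hasDerivAt_flux t).continuousAt

/-- On the region `θ > θ*`, the angle `α` crosses `π` only upwards. -/
lemma alpha_deriv_pos (h : Shot g m₁ m₂ ξ θ α) {t : ℝ} (hθ : thetaStar m₁ m₂ < θ t)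
    (hα : α t = Real.pi) : 0 < Real.sin (α t) * Real.sin (2 * θ t) *
          (Real.exp (4 / (g : ℝ) * ξ t) - mconst g m₁ m₂) +
        2 * Real.cos (α t) * lfun m₁ m₂ (θ t) := by
  have := lfun_neg h.m₁_pos h.m₂_pos hθ (h.theta_mem t).2
  rw [hα]
  simp
  linarith

lemma pi_lt_alpha (h : Shot g m₁ m₂ ξ θ α) {a b : ℝ} (hα : Real.pi ≤ α a)
    (hθ : ∀ t ∈ Icc a b, thetaStar m₁ m₂ < θ t) (hab : a < b) : Real.pi < α b :=
  lt_of_hasDerivAt_pos_of_eq (fun t => (h.sol t).2.2) hα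
    (fun t ht hEq => h.alpha_deriv_pos (hθ t ht) hEq) (right_mem_Ioc.2 hab)

end Shot

/-- `(ξ, θ, α)` leaves `θ = θ*` and is back at time `T`, with `α` staying in `(π/2, 3π/2)`. -/
structure Excursion (g m₁ m₂ : ℕ) (ξ θ α : ℝ → ℝ) (T : ℝ) : Prop extends
    Shot g m₁ m₂ ξ θ α where
  pos : 0 < T
  theta_gt : ∀ t ∈ Ioo 0 T, thetaStar m₁ m₂ < θ t
  alpha_mem : ∀ t ∈ Ioo 0 T, α t ∈ Ioo (Real.pi / 2) (3 * Real.pi / 2)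
  theta_end : θ T = thetaStar m₁ m₂

/-- An excursion whose angle `θ` is maximal at time `t₁`. -/
structure PeakedExcursion (g m₁ m₂ : ℕ) (ξ θ α : ℝ → ℝ) (T t₁ : ℝ) : Prop extends
    Excursion g m₁ m₂ ξ θ α T where
  mem : t₁ ∈ Ioo 0 T
  alpha_peak : α t₁ = Real.pi
  le_peak : ∀ t ∈ Icc 0 T, θ t ≤ θ t₁
  alpha_lt : ∀ t ∈ Ioo 0 t₁, α t < Real.pi
  lt_alpha : ∀ t ∈ Ioo t₁ T, Real.pi < α t

namespace Excursion

variable {g m₁ m₂ : ℕ} {ξ θ α : ℝ → ℝ} {T : ℝ}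

lemma cos_neg (h : Excursion g m₁ m₂ ξ θ α T) {t : ℝ} (ht : t ∈ Ioo 0 T) : Real.cos (α t) < 0 :=
  Real.cos_neg_of_pi_div_two_lt_of_lt (h.alpha_mem t ht).1
    (by linarith [(h.alpha_mem t ht).2])

lemma exists_peak (h : Excursion g m₁ m₂ ξ θ α T) :
    ∃ t₁, PeakedExcursion g m₁ m₂ ξ θ α T t₁ := by
  obtain ⟨t₁, ht₁, hmax⟩ := isCompact_Icc.exists_isMaxOn (nonempty_Icc.2 h.pos.le)
    h.sol.continuous_snd.continuousOn
  have hmid : T / 2 ∈ Ioo 0 T := ⟨by linarith [h.pos], by linarith [h.pos]⟩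
  have hgt : thetaStar m₁ m₂ < θ t₁ :=
    (h.theta_gt _ hmid).trans_le (hmax (Ioo_subset_Icc_self hmid))
  have hmem : t₁ ∈ Ioo 0 T := by
    refine ⟨lt_of_le_of_ne ht₁.1 fun hEq => ?_, lt_of_le_of_ne ht₁.2 fun hEq => ?_⟩
    · rw [← hEq, h.theta_zero] at hgt; exact lt_irrefl _ hgt
    · rw [hEq, h.theta_end] at hgt; exact lt_irrefl _ hgt
  have hd := (hmax.isLocalMax (Icc_mem_nhds hmem.1 hmem.2)).hasDerivAt_eq_zero (h.sol t₁).2.1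
  have hs : Real.sin (α t₁) = 0 := (mul_eq_zero.1 hd).resolve_right (h.sin_two_pos t₁).ne'
  have hα : α t₁ = Real.pi := by
    have hm := h.alpha_mem t₁ hmem
    have h0 : Real.sin (α t₁ - Real.pi) = 0 := by rw [Real.sin_sub_pi, hs, neg_zero]
    have := (Real.sin_eq_zero_iff_of_lt_of_lt (by linarith [hm.1, Real.pi_pos])
      (by linarith [hm.2, Real.pi_pos])).1 h0
    linarith
  refine ⟨t₁, h, hmem, hα, fun t ht => hmax ht, fun t ht => ?_, fun t ht => ?_⟩
  · by_contra! hle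
    exact (h.pi_lt_alpha hle (fun s hs => h.theta_gt s
      ⟨ht.1.trans_le hs.1, hs.2.trans_lt hmem.2⟩) ht.2).ne' hα
  · exact h.pi_lt_alpha hα.ge (fun s hs => h.theta_gt s
      ⟨hmem.1.trans_le hs.1, hs.2.trans_lt ht.2⟩) ht.1

lemma expXi_antitone (h : Excursion g m₁ m₂ ξ θ α T) {a b : ℝ} (ha : 0 ≤ a) (hab : a ≤ b)
    (hb : b ≤ T) : expXi g ξ b ≤ expXi g ξ a := by
  have := le_of_hasDerivAt_nonneg (fun t => (h.hasDerivAt_expXi t).neg) hab fun t ht => ?_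
  · simpa using this
  · have h1 := h.cos_neg ⟨ha.trans_lt ht.1, ht.2.trans_le hb⟩
    have h2 := h.sin_two_pos t
    have h3 := expXi_pos g ξ t
    have h4 : 0 ≤ 4 / (g : ℝ) := by positivity
    have := mul_nonneg (mul_nonneg h4 (mul_nonneg (neg_nonneg.2 h1.le) h2.le)) h3.le
    linarith

lemma flux_nonneg (h : Excursion g m₁ m₂ ξ θ α T) {t : ℝ} (ht : t ∈ Icc 0 T) :
    0 ≤ flux m₁ m₂ θ α t := by
  have hcl : Icc 0 T ⊆ {t | 0 ≤ flux m₁ m₂ θ α t} := by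
    rw [← closure_Ioo h.pos.ne]
    refine closure_minimal (fun t ht => ?_) (isClosed_le continuous_const h.continuous_flux)
    exact mul_nonneg (neg_nonneg.2 (h.cos_neg ht).le) (h.weight_pos t).le
  exact hcl ht

end Excursion

namespace PeakedExcursion

variable {g m₁ m₂ : ℕ} {ξ θ α : ℝ → ℝ} {T t₁ : ℝ}

lemma sin_pos (h : PeakedExcursion g m₁ m₂ ξ θ α T t₁) {t : ℝ} (ht : t ∈ Ioo 0 t₁) :
    0 < Real.sin (α t) :=
  Real.sin_pos_of_pos_of_lt_pi
    (by linarith [(h.alpha_mem t ⟨ht.1, ht.2.trans h.mem.2⟩).1, Real.pi_pos]) (h.alpha_lt t ht)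

lemma sin_neg (h : PeakedExcursion g m₁ m₂ ξ θ α T t₁) {t : ℝ} (ht : t ∈ Ioo t₁ T) :
    Real.sin (α t) < 0 := by
  have h1 := h.alpha_mem t ⟨h.mem.1.trans ht.1, ht.2⟩
  have h2 := Real.sin_pos_of_pos_of_lt_pi (x := α t - Real.pi)
    (by linarith [h.lt_alpha t ht]) (by linarith [h1.2, Real.pi_pos])
  rw [Real.sin_sub_pi] at h2
  linarith

lemma flux_peak (h : PeakedExcursion g m₁ m₂ ξ θ α T t₁) :
    flux m₁ m₂ θ α t₁ = sincosWeight m₁ m₂ (θ t₁) := by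
  simp [flux, h.alpha_peak]

lemma excess_pos (h : PeakedExcursion g m₁ m₂ ξ θ α T t₁) :
    mconst g m₁ m₂ < expXi g ξ 0 := by
  by_contra! hle
  have h1 : flux m₁ m₂ θ α t₁ ≤ flux m₁ m₂ θ α 0 := by
    have := le_of_hasDerivAt_nonneg (fun t => (h.hasDerivAt_flux t).neg) h.mem.1.le
      fun t ht => ?_
    · simpa using this
    · have h2 := h.expXi_antitone le_rfl ht.1.le (ht.2.trans h.mem.2).le
      have h3 := mul_nonneg (mul_nonneg (sq_nonneg (Real.sin (α t))) (h.sin_two_pos t).le)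
        (h.weight_pos t).le
      nlinarith
  rw [h.flux_peak, h.flux_zero] at h1
  linarith [h.weight_pos t₁]

lemma flux_le (h : PeakedExcursion g m₁ m₂ ξ θ α T t₁) {t : ℝ} (ht : t ∈ Icc 0 t₁) :
    flux m₁ m₂ θ α t ≤ 2 * (expXi g ξ 0 - mconst g m₁ m₂) := by
  set ε := expXi g ξ 0 - mconst g m₁ m₂ with hε
  have hε0 : 0 < ε := sub_pos.2 h.excess_pos
  have key := le_of_hasDerivAt_nonneg
    (fun s => ((h.sol s).2.1.const_mul ε).sub (h.hasDerivAt_flux s)) ht.1 fun s hs => ?_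
  · simp only [Pi.sub_apply, h.flux_zero] at key
    have h1 := (h.theta_mem t).2
    have h0 := (h.theta_mem 0).1
    nlinarith [Real.pi_le_four]
  · have hs' : s ∈ Ioo 0 t₁ := ⟨hs.1, hs.2.trans_le ht.2⟩
    have h1 := h.sin_pos hs'
    have h2 := h.sin_two_pos s
    have h3 := h.expXi_antitone le_rfl hs.1.le (hs'.2.trans h.mem.2).le
    have h4 := h.weight_pos s
    have h5 := h.weight_le_one s
    have h6 := Real.sin_le_one (α s)
    have h7 : Real.sin (α s) * sincosWeight m₁ m₂ (θ s) ≤ 1 := mul_le_one₀ h6 h4.le h5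
    have h8 : Real.sin (α s) * sincosWeight m₁ m₂ (θ s) * (expXi g ξ s - mconst g m₁ m₂) ≤ ε := by
      nlinarith [mul_pos h1 h4]
    have h9 := mul_nonneg (mul_pos h1 h2).le (sub_nonneg.2 h8)
    linarith

/-- The depth reached at the peak is controlled by the weight at the peak, because the flux
has to stay nonnegative during the descent. -/
lemma depth_mul_le (h : PeakedExcursion g m₁ m₂ ξ θ α T t₁) {θ₂ w₂ : ℝ}
    (hθ₂ : thetaStar m₁ m₂ < θ₂) (hw₂ : 0 < w₂)
    (hw : ∀ x ∈ Icc (thetaStar m₁ m₂) θ₂, w₂ ≤ sincosWeight m₁ m₂ x)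
    (hM : sincosWeight m₁ m₂ (θ t₁) ≤ w₂ / 2) :
    (mconst g m₁ m₂ - expXi g ξ t₁) * (w₂ / 2 * (θ₂ - thetaStar m₁ m₂)) ≤
      sincosWeight m₁ m₂ (θ t₁) := by
  set D := mconst g m₁ m₂ - expXi g ξ t₁ with hD
  have hκ : 0 < w₂ / 2 * (θ₂ - thetaStar m₁ m₂) := by
    have := sub_pos.2 hθ₂; positivity
  rcases le_or_gt D 0 with hD0 | hD0
  · exact (mul_nonpos_of_nonpos_of_nonneg hD0 hκ.le).trans (h.weight_pos t₁).le
  have hpk : θ₂ < θ t₁ := by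
    by_contra! hle
    linarith [hw _ ⟨(h.theta_gt t₁ h.mem).le, hle⟩]
  obtain ⟨t₂, ht₂, hθt₂⟩ := intermediate_value_Icc' h.mem.2.le h.sol.continuous_snd.continuousOn
    ⟨h.theta_end.trans_le hθ₂.le, hpk.le⟩
  have hexp : ∀ t ∈ Icc t₁ T, expXi g ξ t - mconst g m₁ m₂ ≤ -D := fun t ht => by
    linarith [h.expXi_antitone h.mem.1.le ht.1 ht.2]
  have hflux : ∀ t ∈ Icc t₁ T, flux m₁ m₂ θ α t ≤ sincosWeight m₁ m₂ (θ t₁) := by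
    intro t ht
    rw [← h.flux_peak]
    have := le_of_hasDerivAt_nonneg (fun t => (h.hasDerivAt_flux t).neg) ht.1 fun s hs => ?_
    · simpa using this
    · have h2 := hexp s ⟨hs.1.le, hs.2.le.trans ht.2⟩
      have h3 := mul_nonneg (mul_nonneg (sq_nonneg (Real.sin (α s))) (h.sin_two_pos s).le)
        (h.weight_pos s).le
      nlinarith
  have hθle : ∀ t ∈ Icc t₂ T, θ t ≤ θ₂ := by
    intro t ht
    rw [← hθt₂]
    have := le_of_hasDerivAt_nonneg (fun t => (h.sol t).2.1.neg) ht.1 fun s hs => ?_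
    · simpa using this
    · have h1 := h.sin_neg ⟨ht₂.1.trans_lt hs.1, hs.2.trans_le ht.2⟩
      nlinarith [h.sin_two_pos s]
  have key := le_of_hasDerivAt_nonneg
    (fun s => ((h.sol s).2.1.const_mul (D * (w₂ / 2))).sub (h.hasDerivAt_flux s)) ht₂.2
    fun s hs => ?_
  · simp only [Pi.sub_apply, h.theta_end, hθt₂] at key
    have h1 := h.flux_nonneg (right_mem_Icc.2 h.pos.le)
    have h2 := hflux t₂ ht₂
    linarith
  · have hs1 : s ∈ Ioo t₁ T := ⟨ht₂.1.trans_lt hs.1, hs.2⟩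
    have hs0 : s ∈ Ioo 0 T := ⟨h.mem.1.trans hs1.1, hs.2⟩
    have h1 := h.sin_neg hs1
    have h2 := h.sin_two_pos s
    have h3 := hexp s (Ioo_subset_Icc_self hs1)
    have h4 := hw (θ s) ⟨(h.theta_gt s hs0).le, hθle s (Ioo_subset_Icc_self hs)⟩
    have h5 := hflux s (Ioo_subset_Icc_self hs1)
    have h6 := h.cos_neg hs0
    have h7 : -Real.cos (α s) ≤ 1 / 2 := by
      rw [flux] at h5
      by_contra! hlt
      nlinarith [mul_lt_mul_of_pos_right hlt (hw₂.trans_le h4)]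
    have h8 : 1 / 2 ≤ -Real.sin (α s) := by
      have := Real.sin_sq_add_cos_sq (α s)
      nlinarith
    have h9 : w₂ / 2 ≤ -Real.sin (α s) * sincosWeight m₁ m₂ (θ s) := by nlinarith
    have h10 : D * (w₂ / 2) ≤ -Real.sin (α s) * sincosWeight m₁ m₂ (θ s) *
        -(expXi g ξ s - mconst g m₁ m₂) := by nlinarith
    nlinarith [mul_nonneg (mul_pos (neg_pos.2 h1) h2).le (sub_nonneg.2 h10)]

/-- Shortly after the start, the flux is bounded below by a multiple of the initial excess
`exp((4/g)ξ₀) - m`. -/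
lemma early_flux (h : PeakedExcursion g m₁ m₂ ξ θ α T t₁) {E θ₂ w₂ σ₂ s₀ : ℝ}
    (hE : expXi g ξ 0 ≤ E) (hw₂ : 0 < w₂) (hσ₂ : 0 < σ₂)
    (hw : ∀ x ∈ Icc (thetaStar m₁ m₂) θ₂, w₂ ≤ sincosWeight m₁ m₂ x)
    (hσ : ∀ x ∈ Icc (thetaStar m₁ m₂) θ₂, σ₂ ≤ Real.sin (2 * x))
    (hs₀ : 0 < s₀) (h1 : s₀ ≤ θ₂ - thetaStar m₁ m₂)
    (h2 : (E + mconst g m₁ m₂ + 2 * (m₁ + m₂)) * s₀ ≤ 1 / 2)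
    (h3 : 4 / (g : ℝ) * E * (2 / w₂) * s₀ ≤ 1 / 2) :
    s₀ < t₁ ∧ θ s₀ ≤ θ₂ ∧
      σ₂ * w₂ * s₀ / 8 * (expXi g ξ 0 - mconst g m₁ m₂) ≤ flux m₁ m₂ θ α s₀ := by
  set ε := expXi g ξ 0 - mconst g m₁ m₂ with hε
  have hε0 : 0 < ε := sub_pos.2 h.excess_pos
  have hm := mconst_pos h.g_pos m₁ m₂
  have hE0 : 0 < E := (expXi_pos g ξ 0).trans_le hE
  have hα : ∀ t ∈ Icc 0 T, t ≤ s₀ → |α t - Real.pi / 2| ≤ 1 / 2 := by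
    intro t ht hts
    have := IsSolution.abs_sub_le_of_bound (fun r => (h.sol r).2.2) ht.1
      fun r hr => IsSolution.abs_thd_deriv_le
        ((h.expXi_antitone le_rfl hr.1 (hr.2.trans ht.2)).trans hE)
    rw [h.alpha_zero] at this
    refine this.trans (le_trans ?_ h2)
    refine mul_le_mul_of_nonneg_left (by linarith) (by positivity)
  have hst : s₀ < t₁ := by
    by_contra! hle
    have := hα t₁ (Ioo_subset_Icc_self h.mem) hle
    rw [h.alpha_peak, abs_le] at this
    linarith [Real.pi_gt_three]
  have hθ : ∀ t ∈ Icc 0 s₀, θ t ∈ Icc (thetaStar m₁ m₂) θ₂ := by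
    intro t ht
    have h0 := IsSolution.abs_sub_le_of_bound (fun r => (h.sol r).2.1) ht.1
      fun r hr => IsSolution.abs_snd_deriv_le θ α r
    rw [h.theta_zero, abs_le] at h0
    refine ⟨?_, by linarith [ht.2]⟩
    rcases ht.1.eq_or_lt with h00 | h00
    · rw [← h00, h.theta_zero]
    · exact (h.theta_gt t ⟨h00, ht.2.trans_lt (hst.trans h.mem.2)⟩).le
  have hmemT : ∀ t ∈ Ioo 0 s₀, t ∈ Ioo 0 T := fun t ht =>
    ⟨ht.1, ht.2.trans (hst.trans h.mem.2)⟩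
  have hexp : ∀ t ∈ Icc 0 s₀, ε / 2 ≤ expXi g ξ t - mconst g m₁ m₂ := by
    intro t ht
    set K := 4 / (g : ℝ) * E * (2 / w₂) * ε with hK
    have key := le_of_hasDerivAt_nonneg
      (fun s => (h.hasDerivAt_expXi s).add ((hasDerivAt_id s).const_mul K)) ht.1 fun s hs => ?_
    · simp only [Pi.add_apply, id] at key
      have : K * t ≤ ε / 2 := by
        have hle : K * t ≤ K * s₀ := mul_le_mul_of_nonneg_left ht.2 (by positivity)
        have : K * s₀ = (4 / (g : ℝ) * E * (2 / w₂) * s₀) * ε := by rw [hK]; ring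
        nlinarith
      linarith
    · have hs' : s ∈ Ioo 0 s₀ := ⟨hs.1, hs.2.trans_le ht.2⟩
      have h4 := hw _ (hθ s (Ioo_subset_Icc_self hs'))
      have h5 := h.flux_le ⟨hs.1.le, (hs'.2.trans hst).le⟩
      have h6 := h.cos_neg (hmemT s hs')
      have h7 : -Real.cos (α s) ≤ 2 / w₂ * ε := by
        rw [flux] at h5
        rw [div_mul_eq_mul_div, le_div_iff₀ hw₂]
        exact (mul_le_mul_of_nonneg_left h4 (neg_nonneg.2 h6.le)).trans h5
      have h8 := (h.expXi_antitone le_rfl hs.1.le (hmemT s hs').2.le).trans hE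
      have h9 := expXi_pos g ξ s
      have h10 : -Real.cos (α s) * Real.sin (2 * θ s) ≤ 2 / w₂ * ε := by
        have := mul_le_mul_of_nonneg_left (Real.sin_le_one (2 * θ s)) (neg_nonneg.2 h6.le)
        linarith
      have h11 : -Real.cos (α s) * Real.sin (2 * θ s) * expXi g ξ s ≤ 2 / w₂ * ε * E :=
        mul_le_mul h10 h8 h9.le (by positivity)
      have h12 : (0 : ℝ) ≤ 4 / g := by positivity
      have h13 := mul_le_mul_of_nonneg_left h11 h12
      rw [hK]
      linarith
  refine ⟨hst, (hθ s₀ (right_mem_Icc.2 hs₀.le)).2, ?_⟩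
  have key := le_of_hasDerivAt_nonneg
    (fun s => (h.hasDerivAt_flux s).sub ((hasDerivAt_id s).const_mul (σ₂ * w₂ / 8 * ε))) hs₀.le
    fun s hs => ?_
  · simp only [Pi.sub_apply, id, h.flux_zero] at key
    linarith
  · have hs' := Ioo_subset_Icc_self hs
    have h4 := hw _ (hθ s hs')
    have h5 := hσ _ (hθ s hs')
    have h6 := hexp s hs'
    have h7 : 1 / 2 ≤ Real.sin (α s) := by
      have h8 := hα s (Ioo_subset_Icc_self (hmemT s hs)) hs.2.le
      have h9 := Real.one_sub_sq_div_two_le_cos (x := α s - Real.pi / 2)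
      rw [Real.cos_sub_pi_div_two] at h9
      have := abs_le.1 h8
      nlinarith
    have h8 : 1 / 4 ≤ Real.sin (α s) ^ 2 := by nlinarith
    have h9 : 1 / 4 * σ₂ ≤ Real.sin (α s) ^ 2 * Real.sin (2 * θ s) :=
      mul_le_mul h8 h5 hσ₂.le (sq_nonneg _)
    have h10 : 1 / 4 * σ₂ * w₂ ≤ Real.sin (α s) ^ 2 * Real.sin (2 * θ s) *
        sincosWeight m₁ m₂ (θ s) := mul_le_mul h9 h4 hw₂.le (by nlinarith)
    have h11 : 1 / 4 * σ₂ * w₂ * (ε / 2) ≤ Real.sin (α s) ^ 2 * Real.sin (2 * θ s) *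
        sincosWeight m₁ m₂ (θ s) * (expXi g ξ s - mconst g m₁ m₂) :=
      mul_le_mul h10 h6 (by positivity) (le_trans (by positivity) h10)
    linarith

lemma log_cos_peak_ge (h : PeakedExcursion g m₁ m₂ ξ θ α T t₁) {θ₂ κ₀ c₁ s₀ : ℝ}
    (hs₀ : s₀ ∈ Ioo 0 t₁) (hκ₀ : 0 < κ₀) (hc₁ : 0 < c₁) (hθ : θ s₀ ≤ θ₂) (hθ₂ : θ₂ < Real.pi / 2)
    (hearly : c₁ * (expXi g ξ 0 - mconst g m₁ m₂) ≤ flux m₁ m₂ θ α s₀)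
    (hdepth : (mconst g m₁ m₂ - expXi g ξ t₁) * κ₀ ≤ sincosWeight m₁ m₂ (θ t₁))
    (hM : sincosWeight m₁ m₂ (θ t₁) ≤ mconst g m₁ m₂ * κ₀ / 2) :
    Real.log (Real.cos θ₂) -
        (1 + 2 / κ₀) / (2 * mconst g m₁ m₂ / g * (c₁ / (1 + 2 / κ₀))) ≤
      Real.log (Real.cos (θ t₁)) := by
  set ε := expXi g ξ 0 - mconst g m₁ m₂ with hε
  set M := sincosWeight m₁ m₂ (θ t₁) with hMdef
  set m := mconst g m₁ m₂ with hmdef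
  have hε0 : 0 < ε := sub_pos.2 h.excess_pos
  have hm : 0 < m := mconst_pos h.g_pos m₁ m₂
  have hg : (0 : ℝ) < g := by exact_mod_cast h.g_pos
  have hM0 : 0 < M := h.weight_pos t₁
  have hMε : M ≤ 2 * ε := by
    rw [hMdef, ← h.flux_peak]
    exact h.flux_le (right_mem_Icc.2 h.mem.1.le)
  set c₂ := c₁ / (1 + 2 / κ₀) with hc₂
  have hq : 0 < 1 + 2 / κ₀ := by positivity
  have hc₂0 : 0 < c₂ := by positivity
  have hc₂₁ : c₂ ≤ c₁ := div_le_self hc₁.le (by linarith [div_pos two_pos hκ₀])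
  have hpeak : m - M / κ₀ ≤ expXi g ξ t₁ := by
    have := (le_div_iff₀ hκ₀).2 hdepth
    linarith
  have hM2 : M / κ₀ ≤ m / 2 := by
    rw [div_le_iff₀ hκ₀]; linarith
  have hMε' : M / κ₀ ≤ 2 * ε / κ₀ := by gcongr
  have hT : ∀ t ∈ Ioo s₀ t₁, t ∈ Ioo 0 t₁ := fun t ht => ⟨hs₀.1.trans ht.1, ht.2⟩
  have hexp : ∀ t ∈ Ioo s₀ t₁, expXi g ξ t₁ ≤ expXi g ξ t := fun t ht =>
    h.expXi_antitone (hT t ht).1.le ht.2.le h.mem.2.le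
  have hfac : ∀ t, 0 ≤ Real.sin (α t) ^ 2 * Real.sin (2 * θ t) * sincosWeight m₁ m₂ (θ t) :=
    fun t => mul_nonneg (mul_nonneg (sq_nonneg _) (h.sin_two_pos t).le) (h.weight_pos t).le
  have hMge : c₂ * ε ≤ M := by
    have key := le_of_hasDerivAt_nonneg
      (fun s => (h.hasDerivAt_flux s).add ((h.sol s).2.1.const_mul (M / κ₀))) hs₀.2.le
      fun s hs => ?_
    · simp only [Pi.add_apply, h.flux_peak] at key
      have hθ2 : M / κ₀ * (θ t₁ - θ s₀) ≤ M / κ₀ * 2 := by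
        refine mul_le_mul_of_nonneg_left ?_ (by positivity)
        linarith [(h.theta_mem t₁).2, (h.theta_mem s₀).1, Real.pi_le_four]
      have : c₁ * ε ≤ M * (1 + 2 / κ₀) := by
        have : M * (1 + 2 / κ₀) = M + M / κ₀ * 2 := by ring
        linarith
      rw [hc₂, div_mul_eq_mul_div, div_le_iff₀ hq]
      exact this
    · have h1 := h.sin_pos (hT s hs)
      have h2 := h.sin_two_pos s
      have h3 := hexp s hs
      have h7 : Real.sin (α s) * sincosWeight m₁ m₂ (θ s) ≤ 1 :=
        mul_le_one₀ (Real.sin_le_one _) (h.weight_pos s).le (h.weight_le_one s)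
      have h8 : 0 ≤ Real.sin (α s) * sincosWeight m₁ m₂ (θ s) * (expXi g ξ s - m) + M / κ₀ := by
        have : 0 < M / κ₀ := by positivity
        nlinarith [mul_pos h1 (h.weight_pos s)]
      have h9 := mul_nonneg (mul_pos h1 h2).le h8
      linarith
  have hflux : ∀ t ∈ Ioo s₀ t₁, c₂ * ε ≤ flux m₁ m₂ θ α t := by
    intro t ht
    rcases le_total m (expXi g ξ t) with hc | hc
    · have := le_of_hasDerivAt_nonneg h.hasDerivAt_flux ht.1.le fun s hs => ?_
      · have := mul_le_mul_of_nonneg_right hc₂₁ hε0.le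
        linarith
      · have := h.expXi_antitone (hs₀.1.trans hs.1).le hs.2.le (ht.2.trans h.mem.2).le
        exact mul_nonneg (hfac s) (by linarith)
    · have := le_of_hasDerivAt_nonneg (fun s => (h.hasDerivAt_flux s).neg) ht.2.le fun s hs => ?_
      · simp only [Pi.neg_apply, h.flux_peak] at this
        linarith
      · have := h.expXi_antitone (hT t ht).1.le hs.1.le (hs.2.trans h.mem.2).le
        have := mul_nonneg (hfac s) (show 0 ≤ m - expXi g ξ s by linarith)
        linarith
  set K := 2 * m / g * c₂ with hK
  have hK0 : 0 < K := by positivity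
  have hcos : ∀ t, 0 < Real.cos (θ t) := fun t => (sin_cos_pos (h.theta_mem t)).2
  have key := le_of_hasDerivAt_nonneg
    (fun s => (((h.sol s).2.1.cos.log (hcos s).ne').const_mul (K * ε)).sub
      (h.hasDerivAt_expXi s)) hs₀.2.le fun s hs => ?_
  · simp only [Pi.sub_apply] at key
    have h1 : expXi g ξ s₀ ≤ expXi g ξ 0 :=
      h.expXi_antitone le_rfl hs₀.1.le (hs₀.2.trans h.mem.2).le
    have h2 : Real.log (Real.cos θ₂) ≤ Real.log (Real.cos (θ s₀)) := by
      refine Real.log_le_log (Real.cos_pos_of_mem_Ioo ⟨?_, hθ₂⟩) ?_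
      · linarith [(h.theta_mem s₀).1, Real.pi_pos]
      · exact Real.cos_le_cos_of_nonneg_of_le_pi (h.theta_mem s₀).1.le
          (by linarith [Real.pi_pos]) hθ
    have h3 : K * ε * Real.log (Real.cos θ₂) ≤ K * ε * Real.log (Real.cos (θ s₀)) :=
      mul_le_mul_of_nonneg_left h2 (by positivity)
    have h4 : K * ε * (Real.log (Real.cos θ₂) - (1 + 2 / κ₀) / K) ≤
        K * ε * Real.log (Real.cos (θ t₁)) := by
      have : K * ε * (Real.log (Real.cos θ₂) - (1 + 2 / κ₀) / K) =
          K * ε * Real.log (Real.cos θ₂) - (ε + 2 * ε / κ₀) := by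
        field_simp
      rw [this]
      linarith
    exact le_of_mul_le_mul_left h4 (by positivity)
  · have hs1 := hT s hs
    have hs0 : s ∈ Ioo 0 T := ⟨hs1.1, hs1.2.trans h.mem.2⟩
    have h1 := h.sin_pos hs1
    have h2 := h.sin_two_pos s
    have h3 : m / 2 ≤ expXi g ξ s := by linarith [hexp s hs]
    have h4 := hflux s hs
    have h5 := h.cos_neg hs0
    have h6 : c₂ * ε ≤ -Real.cos (α s) * Real.cos (θ s) :=
      h4.trans (mul_le_mul_of_nonneg_left (sincosWeight_le_cos m₁ h.m₂_pos (h.theta_mem s))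
        (neg_nonneg.2 h5.le))
    have hsθ := (sin_cos_pos (h.theta_mem s)).1
    have h7 : Real.sin (θ s) * Real.sin (α s) ≤ 1 :=
      mul_le_one₀ (Real.sin_le_one _) h1.le (Real.sin_le_one _)
    have h8 : c₂ * ε / Real.cos (θ s) ≤ -Real.cos (α s) := (div_le_iff₀ (hcos s)).2 h6
    have h9 : c₂ * ε / Real.cos (θ s) * (Real.sin (θ s) * Real.sin (α s)) * (m / 2) ≤
        -Real.cos (α s) * 1 * expXi g ξ s := by
      refine mul_le_mul (mul_le_mul h8 h7 (by positivity) (by linarith)) h3 (by positivity)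
        (by linarith)
    have h10 := mul_le_mul_of_nonneg_left h9 (show 0 ≤ 4 / (g : ℝ) * Real.sin (2 * θ s) by positivity)
    have h11 : K * ε * (-Real.sin (θ s) * (Real.sin (α s) * Real.sin (2 * θ s)) / Real.cos (θ s)) =
        -(4 / (g : ℝ) * Real.sin (2 * θ s) *
          (c₂ * ε / Real.cos (θ s) * (Real.sin (θ s) * Real.sin (α s)) * (m / 2))) := by
      rw [hK]; field_simp; ring
    rw [h11]
    linarith

end PeakedExcursion

/-- During an excursion, `θ` stays away from `π/2`, uniformly for bounded initial values. -/
lemma exists_cos_lower_bound {g m₁ m₂ : ℕ} (hg : 0 < g) (hm₁ : 0 < m₁) (hm₂ : 0 < m₂) (E : ℝ) :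
    ∃ κ > 0, ∀ (ξ θ α : ℝ → ℝ) (T : ℝ), Excursion g m₁ m₂ ξ θ α T → expXi g ξ 0 ≤ E →
      ∀ t ∈ Icc 0 T, κ ≤ Real.cos (θ t) := by
  wlog hE : 0 < E
  · refine ⟨1, one_pos, fun ξ θ α T _ hle => ?_⟩
    linarith [expXi_pos g ξ 0]
  have h0 := thetaStar_pos hm₁ hm₂
  obtain ⟨θ₂, hθ₂, hθ₂'⟩ := exists_between (thetaStar_lt m₁ m₂)
  have hm := mconst_pos hg m₁ m₂
  have hsub : ∀ x ∈ Icc (thetaStar m₁ m₂) θ₂, x ∈ Ioo 0 (Real.pi / 2) := fun x hx =>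
    ⟨h0.trans_le hx.1, hx.2.trans_lt hθ₂'⟩
  have hmin : ∀ f : ℝ → ℝ, Continuous f → (∀ x ∈ Ioo 0 (Real.pi / 2), 0 < f x) →
      ∃ c > 0, ∀ x ∈ Icc (thetaStar m₁ m₂) θ₂, c ≤ f x := by
    intro f hf hpos
    obtain ⟨x₀, hx₀, hx₀'⟩ := isCompact_Icc.exists_isMinOn (nonempty_Icc.2 hθ₂.le) hf.continuousOn
    exact ⟨f x₀, hpos _ (hsub _ hx₀), fun x hx => hx₀' hx⟩
  obtain ⟨w₂, hw₂, hw⟩ := hmin (sincosWeight m₁ m₂) (by unfold sincosWeight; fun_prop)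
    fun x hx => sincosWeight_pos m₁ m₂ hx
  obtain ⟨σ₂, hσ₂, hσ⟩ := hmin (fun x => Real.sin (2 * x)) (by fun_prop)
    fun x hx => sin_two_mul_pos hx
  obtain ⟨s₀, hs₀, h1, h2, h3⟩ : ∃ s₀ > 0, s₀ ≤ θ₂ - thetaStar m₁ m₂ ∧
      (E + mconst g m₁ m₂ + 2 * (m₁ + m₂)) * s₀ ≤ 1 / 2 ∧
      4 / (g : ℝ) * E * (2 / w₂) * s₀ ≤ 1 / 2 := by
    have hlim : ∀ C : ℝ, ∀ᶠ s in 𝓝[>] (0 : ℝ), C * s ≤ 1 / 2 := fun C =>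
      ((Continuous.tendsto' (by fun_prop) (0 : ℝ) 0 (by simp) :
        Tendsto (fun s => C * s) (𝓝 0) (𝓝 0)).mono_left nhdsWithin_le_nhds).eventually
        (ge_mem_nhds (by norm_num))
    obtain ⟨s, ⟨hs1, hs2⟩, hs3, hs4⟩ := ((hlim _).and (hlim _)).and
      ((eventually_mem_nhdsWithin).and
        (Ioc_mem_nhdsGT (sub_pos.2 hθ₂) : ∀ᶠ s in 𝓝[>] (0 : ℝ), _)) |>.exists
    exact ⟨s, hs3, hs4.2, hs1, hs2⟩
  set κ₀ := w₂ / 2 * (θ₂ - thetaStar m₁ m₂) with hκ₀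
  have hκ₀0 : 0 < κ₀ := by have := sub_pos.2 hθ₂; positivity
  set L := Real.log (Real.cos θ₂) - (1 + 2 / κ₀) /
    (2 * mconst g m₁ m₂ / g * (σ₂ * w₂ * s₀ / 8 / (1 + 2 / κ₀))) with hL
  refine ⟨min (min (w₂ / 2) (mconst g m₁ m₂ * κ₀ / 2)) (Real.exp L), by positivity,
    fun ξ θ α T hexc hle => ?_⟩
  obtain ⟨t₁, h⟩ := hexc.exists_peak
  have hpeak : min (min (w₂ / 2) (mconst g m₁ m₂ * κ₀ / 2)) (Real.exp L) ≤ Real.cos (θ t₁) := by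
    have hwc := sincosWeight_le_cos m₁ hm₂ (h.theta_mem t₁)
    by_cases hM : sincosWeight m₁ m₂ (θ t₁) ≤ min (w₂ / 2) (mconst g m₁ m₂ * κ₀ / 2)
    · obtain ⟨ha, hb, hc⟩ := h.early_flux hle hw₂ hσ₂ hw hσ hs₀ h1 h2 h3
      refine (min_le_right _ _).trans ?_
      rw [← Real.le_log_iff_exp_le (sin_cos_pos (h.theta_mem t₁)).2]
      exact h.log_cos_peak_ge ⟨hs₀, ha⟩ hκ₀0 (by positivity) hb hθ₂' hc
        (h.depth_mul_le hθ₂ hw₂ hw (hM.trans (min_le_left _ _))) (hM.trans (min_le_right _ _))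
    · exact (min_le_left _ _).trans ((not_le.1 hM).le.trans hwc)
  intro t ht
  exact hpeak.trans (Real.cos_le_cos_of_nonneg_of_le_pi (h.theta_mem t).1.le
    (by linarith [(h.theta_mem t₁).2, Real.pi_pos]) (h.le_peak t ht))

/-! ### Solutions that never return do not exist -/

lemma not_bddAbove_of_deriv_ge {f f' : ℝ → ℝ} (hf : ∀ t, HasDerivAt f (f' t) t) {a B c : ℝ}
    (hc : 0 < c) (h : ∀ t > a, c ≤ f' t) (hB : ∀ t ≥ a, f t ≤ B) : False := by
  have key := le_of_hasDerivAt_nonneg (f := fun t => f t - c * t) (f' := fun t => f' t - c)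
    (fun t => by simpa using (hf t).fun_sub ((hasDerivAt_id t).const_mul c))
    (a := a) (b := a + (B - f a) / c + 1)
    (by have := div_nonneg (sub_nonneg.2 (hB a le_rfl)) hc.le; linarith)
    (fun t ht => sub_nonneg.2 (h t ht.1))
  have h1 := div_nonneg (sub_nonneg.2 (hB a le_rfl)) hc.le
  have h2 := hB (a + (B - f a) / c + 1) (by linarith)
  have h3 : c * (a + (B - f a) / c + 1) = c * a + (B - f a) + c := by field_simp
  simp only [h3] at key
  linarith

/-- A shot that stays in the region `θ > θ*`, `α ∈ [π/2, 3π/2]`, `cos θ ≥ κ`. -/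
structure TrappedShot (g m₁ m₂ : ℕ) (ξ θ α : ℝ → ℝ) (κ : ℝ) : Prop extends
    Shot g m₁ m₂ ξ θ α where
  κ_pos : 0 < κ
  theta_gt : ∀ t > 0, thetaStar m₁ m₂ < θ t
  alpha_mem : ∀ t ≥ 0, α t ∈ Icc (Real.pi / 2) (3 * Real.pi / 2)
  le_cos : ∀ t ≥ 0, κ ≤ Real.cos (θ t)

namespace TrappedShot

variable {g m₁ m₂ : ℕ} {ξ θ α : ℝ → ℝ} {κ : ℝ}

lemma exists_le_sin_two (h : TrappedShot g m₁ m₂ ξ θ α κ) :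
    ∃ s > 0, ∀ t ≥ 0, s ≤ Real.sin (2 * θ t) := by
  have h0 := thetaStar_pos h.m₁_pos h.m₂_pos
  have hs := (sin_cos_pos ⟨h0, thetaStar_lt m₁ m₂⟩).1
  have hκ := h.κ_pos
  refine ⟨2 * Real.sin (thetaStar m₁ m₂) * κ, by positivity, fun t ht => ?_⟩
  rw [Real.sin_two_mul]
  have h1 : Real.sin (thetaStar m₁ m₂) ≤ Real.sin (θ t) := by
    refine Real.sin_le_sin_of_le_of_le_pi_div_two (by linarith [Real.pi_pos]) (h.theta_mem t).2.le ?_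
    rcases ht.eq_or_lt with rfl | ht
    · exact h.theta_zero.ge
    · exact (h.theta_gt t ht).le
  exact mul_le_mul (by linarith) (h.le_cos t ht) hκ.le (by linarith)

lemma cos_nonpos (h : TrappedShot g m₁ m₂ ξ θ α κ) {t : ℝ} (ht : 0 ≤ t) :
    Real.cos (α t) ≤ 0 :=
  Real.cos_nonpos_of_pi_div_two_le_of_le (h.alpha_mem t ht).1 (by linarith [(h.alpha_mem t ht).2])

lemma exists_pi_lt (h : TrappedShot g m₁ m₂ ξ θ α κ) : ∃ t ≥ 0, Real.pi < α t := by
  by_contra! hle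
  obtain ⟨s, hs, hsin⟩ := h.exists_le_sin_two
  have hα0 : ∀ t ≥ 0, 0 ≤ Real.sin (α t) := fun t ht =>
    Real.sin_nonneg_of_nonneg_of_le_pi (by linarith [(h.alpha_mem t ht).1, Real.pi_pos]) (hle t ht)
  obtain ⟨c, hc, hl⟩ : ∃ c > 0, ∀ t > 1, lfun m₁ m₂ (θ t) ≤ -c := by
    refine ⟨-lfun m₁ m₂ (θ 1), neg_pos.2 (lfun_neg h.m₁_pos h.m₂_pos (h.theta_gt 1 one_pos)
      (h.theta_mem 1).2), fun t ht => ?_⟩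
    rw [neg_neg]
    have hmono : θ 1 ≤ θ t := le_of_hasDerivAt_nonneg (fun t => (h.sol t).2.1) ht.le fun r hr =>
      mul_nonneg (hα0 r (by linarith [hr.1])) (h.sin_two_pos r).le
    rcases hmono.eq_or_lt with hEq | hlt
    · rw [hEq]
    · exact (lfun_lt_of_lt h.m₂_pos (h.theta_mem 1).1.le hlt (h.theta_mem t).2.le).le
  have hm := mconst_pos h.g_pos m₁ m₂
  refine not_bddAbove_of_deriv_ge (f := fun t => α t + (mconst g m₁ m₂ + 2 * c / s) * θ t)
    (fun t => (h.sol t).2.2.add ((h.sol t).2.1.const_mul (mconst g m₁ m₂ + 2 * c / s)))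
    (a := 1) (c := 2 * c) (B := Real.pi + (mconst g m₁ m₂ + 2 * c / s) * (Real.pi / 2))
    (by positivity) (fun t ht => ?_) (fun t ht => ?_)
  · have ht0 : 0 ≤ t := by linarith
    have h1 := hα0 t ht0
    have h2 := h.cos_nonpos ht0
    have h3 := hsin t ht0
    have h4 := hl t ht
    have h5 : 1 ≤ Real.sin (α t) - Real.cos (α t) := by
      nlinarith [Real.sin_sq_add_cos_sq (α t), Real.sin_le_one (α t), Real.neg_one_le_cos (α t)]
    have h6 : 0 ≤ Real.sin (α t) * Real.sin (2 * θ t) * Real.exp (4 / (g : ℝ) * ξ t) := by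
      have := h.sin_two_pos t
      positivity
    have h7 : 2 * c * Real.sin (α t) ≤
        2 * c / s * (Real.sin (α t) * Real.sin (2 * θ t)) := by
      calc 2 * c * Real.sin (α t) = 2 * c / s * (Real.sin (α t) * s) := by field_simp
        _ ≤ _ := by gcongr
    have h8 : Real.cos (α t) * -c ≤ Real.cos (α t) * lfun m₁ m₂ (θ t) :=
      mul_le_mul_of_nonpos_left h4 h2
    have h9 : c * 1 ≤ c * (Real.sin (α t) - Real.cos (α t)) := by gcongr
    linarith
  · have := (h.theta_mem t).2.le
    have := hle t (by linarith)
    gcongr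

lemma exists_pi_lt_forall (h : TrappedShot g m₁ m₂ ξ θ α κ) :
    ∃ t₀ > 0, α t₀ = Real.pi ∧ ∀ t > t₀, Real.pi < α t := by
  obtain ⟨a, ha, haπ⟩ := h.exists_pi_lt
  obtain ⟨t₀, ht₀, hEq⟩ := intermediate_value_Icc ha h.sol.continuous_thd.continuousOn
    (show Real.pi ∈ Icc (α 0) (α a) from ⟨by rw [h.alpha_zero]; linarith [Real.pi_pos], haπ.le⟩)
  have hpos : 0 < t₀ := by
    refine lt_of_le_of_ne ht₀.1 fun h0 => ?_
    rw [← h0, h.alpha_zero] at hEq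
    linarith [Real.pi_pos]
  exact ⟨t₀, hpos, hEq, fun t ht => h.pi_lt_alpha hEq.ge
    (fun s hs => h.theta_gt s (hpos.trans_le hs.1)) ht⟩

lemma exists_expXi_lt (h : TrappedShot g m₁ m₂ ξ θ α κ) {t₀ : ℝ} (ht₀ : 0 < t₀)
    (hα : α t₀ = Real.pi) : ∃ t > t₀, expXi g ξ t < mconst g m₁ m₂ := by
  by_contra! hle
  obtain ⟨s, hs, hsin⟩ := h.exists_le_sin_two
  have hg : (0 : ℝ) < g := by exact_mod_cast h.g_pos
  have hw := h.weight_pos t₀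
  refine not_bddAbove_of_deriv_ge (f := fun t => -(4 / (g : ℝ) * ξ t))
    (fun t => ((h.sol t).1.const_mul (4 / (g : ℝ))).neg) (a := t₀ + 1)
    (c := 4 / (g : ℝ) * (sincosWeight m₁ m₂ (θ t₀) * s)) (B := -Real.log (mconst g m₁ m₂))
    (by positivity) (fun t ht => ?_) (fun t ht => ?_)
  · have ht' : t₀ ≤ t := by linarith
    have hfl : flux m₁ m₂ θ α t₀ ≤ flux m₁ m₂ θ α t :=
      le_of_hasDerivAt_nonneg h.hasDerivAt_flux ht' fun r hr =>
        mul_nonneg (mul_nonneg (mul_nonneg (sq_nonneg _) (h.sin_two_pos r).le)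
          (h.weight_pos r).le) (sub_nonneg.2 (hle r hr.1))
    simp only [flux, hα, Real.cos_pi, neg_neg, one_mul] at hfl
    have hcos := h.cos_nonpos (ht₀.le.trans ht')
    have h1 : sincosWeight m₁ m₂ (θ t₀) ≤ -Real.cos (α t) :=
      hfl.trans (mul_le_of_le_one_right (neg_nonneg.2 hcos) (h.weight_le_one t))
    calc 4 / (g : ℝ) * (sincosWeight m₁ m₂ (θ t₀) * s)
        ≤ 4 / (g : ℝ) * (-Real.cos (α t) * Real.sin (2 * θ t)) := by
          gcongr
          · exact neg_nonneg.2 hcos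
          · exact hsin t (ht₀.le.trans ht')
      _ = _ := by ring
  · have := (Real.log_le_iff_le_exp (mconst_pos h.g_pos m₁ m₂)).2 (hle t (by linarith))
    exact neg_le_neg this

lemma false (h : TrappedShot g m₁ m₂ ξ θ α κ) : False := by
  obtain ⟨t₀, ht₀, hα₀, hα⟩ := h.exists_pi_lt_forall
  obtain ⟨t₂, ht₂, hlt⟩ := h.exists_expXi_lt ht₀ hα₀
  obtain ⟨s, hs, hsin⟩ := h.exists_le_sin_two
  have h02 : 0 ≤ t₂ := by linarith
  have hneg : ∀ t ≥ t₂, Real.sin (α t) ≤ 0 := fun t ht => by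
    have h1 := hα t (ht₂.trans_le ht)
    have h2 := (h.alpha_mem t (h02.trans ht)).2
    have := Real.sin_nonneg_of_nonneg_of_le_pi (x := α t - Real.pi) (by linarith)
      (by linarith [Real.pi_pos])
    rw [Real.sin_sub_pi] at this
    linarith
  have hE : ∀ t ≥ t₂, expXi g ξ t ≤ mconst g m₁ m₂ := fun t ht => by
    have := le_of_hasDerivAt_nonneg (fun r => (h.hasDerivAt_expXi r).neg) ht fun r hr => ?_
    · exact (neg_le_neg_iff.1 this).trans hlt.le
    · have h1 := h.cos_nonpos (h02.trans hr.1.le)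
      have h2 := h.sin_two_pos r
      have h3 := expXi_pos g ξ r
      have h4 : 0 ≤ 4 / (g : ℝ) := by positivity
      have := mul_nonneg (mul_nonneg h4 (mul_nonneg (neg_nonneg.2 h1) h2.le)) h3.le
      linarith
  have hmono : ∀ t ≥ t₂, α t₂ ≤ α t := fun t ht =>
    le_of_hasDerivAt_nonneg (fun r => (h.sol r).2.2) ht fun r hr => by
      have hr0 : 0 < r := h02.trans_lt hr.1
      have h1 := mul_nonneg (mul_nonneg (neg_nonneg.2 (hneg r hr.1.le)) (h.sin_two_pos r).le)
        (sub_nonneg.2 (hE r hr.1.le))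
      have h2 := mul_nonneg (neg_nonneg.2 (h.cos_nonpos hr0.le)) (neg_nonneg.2
        (lfun_neg h.m₁_pos h.m₂_pos (h.theta_gt r hr0) (h.theta_mem r).2).le)
      simp only [expXi] at h1
      linarith
  have hα₂ := hα t₂ ht₂
  have hsin₂ : 0 < -Real.sin (α t₂) := by
    rw [← Real.sin_sub_pi]
    exact Real.sin_pos_of_pos_of_lt_pi (by linarith)
      (by linarith [(h.alpha_mem t₂ h02).2, Real.pi_pos])
  refine not_bddAbove_of_deriv_ge (fun t => (h.sol t).2.1.neg) (a := t₂)
    (c := -Real.sin (α t₂) * s) (B := 0) (by positivity) (fun t ht => ?_)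
    (fun t _ => neg_nonpos.2 (h.theta_mem t).1.le)
  have h1 : Real.sin (α t₂ - Real.pi) ≤ Real.sin (α t - Real.pi) :=
    Real.sin_le_sin_of_le_of_le_pi_div_two (by linarith [Real.pi_pos])
      (by linarith [(h.alpha_mem t (h02.trans ht.le)).2]) (by linarith [hmono t ht.le])
  rw [Real.sin_sub_pi, Real.sin_sub_pi] at h1
  calc -Real.sin (α t₂) * s ≤ -Real.sin (α t) * Real.sin (2 * θ t) :=
        mul_le_mul h1 (hsin t (h02.trans ht.le)) hs.le (hsin₂.le.trans h1)
    _ = _ := by ring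

end TrappedShot

/-! ### Explicit solutions -/

namespace IsSolution

variable {g m₁ m₂ : ℕ} {ξ θ α : ℝ → ℝ}

lemma arctan_exp {a x : ℝ} (b : ℝ) (ha : Real.cos a = 0)
    (hx : Real.exp (4 / (g : ℝ) * x) = mconst g m₁ m₂) :
    IsSolution g m₁ m₂ (fun _ => x) (fun t => Real.arctan (b * Real.exp (2 * Real.sin a * t)))
      (fun _ => a) := by
  intro t
  refine ⟨by simpa [ha] using hasDerivAt_const t x, ?_,
    by simpa [ha, hx] using hasDerivAt_const t a⟩
  have h1 : HasDerivAt (fun t => b * Real.exp (2 * Real.sin a * t))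
      (b * (Real.exp (2 * Real.sin a * t) * (2 * Real.sin a))) t := by
    simpa using (((hasDerivAt_id t).const_mul (2 * Real.sin a)).exp).const_mul b
  refine h1.arctan.congr_deriv ?_
  have h2 : ∀ u : ℝ, Real.sin (2 * Real.arctan u) = 2 * u / (1 + u ^ 2) := by
    intro u
    have hu : (0 : ℝ) < 1 + u ^ 2 := by positivity
    rw [Real.sin_two_mul, Real.sin_arctan, Real.cos_arctan]
    have := Real.mul_self_sqrt hu.le
    field_simp
    rw [Real.sq_sqrt hu.le]
  rw [h2]
  ring

lemma eq_of_cos_eq_zero (h : IsSolution g m₁ m₂ ξ θ α) {T : ℝ}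
    (hθ : θ T ∈ Ioo 0 (Real.pi / 2)) (hα : Real.cos (α T) = 0)
    (hξ : expXi g ξ T = mconst g m₁ m₂) (t : ℝ) : ξ t = ξ T ∧ α t = α T := by
  have h' := h.unique (arctan_exp (Real.tan (θ T) * Real.exp (-(2 * Real.sin (α T) * T))) hα hξ)
    (t₀ := T) rfl ?_ rfl t
  · exact ⟨h'.1, h'.2.2⟩
  · rw [mul_assoc, ← Real.exp_add, neg_add_cancel, Real.exp_zero, mul_one,
      Real.arctan_tan (by linarith [hθ.1, Real.pi_pos]) hθ.2]

lemma eq_of_sin_eq_zero (h : IsSolution g m₁ m₂ ξ θ α) (hm₂ : 0 < m₂) {T : ℝ}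
    (hθ : θ T = thetaStar m₁ m₂) (hα : Real.sin (α T) = 0) (t : ℝ) : α t = α T := by
  have hs : IsSolution g m₁ m₂
      (fun t => ξ T + Real.cos (α T) * Real.sin (2 * thetaStar m₁ m₂) * (t - T))
      (fun _ => thetaStar m₁ m₂) (fun _ => α T) := by
    intro t
    refine ⟨?_, by simpa [hα] using hasDerivAt_const t (thetaStar m₁ m₂),
      by simpa [hα, lfun_thetaStar m₁ hm₂] using hasDerivAt_const t (α T)⟩
    simpa using (((hasDerivAt_id t).sub_const T).const_mul
      (Real.cos (α T) * Real.sin (2 * thetaStar m₁ m₂))).const_add (ξ T)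
  exact (h.unique hs (t₀ := T) (by simp) hθ rfl t).2.2

end IsSolution

/-! ### The shooting family -/

lemma lt_of_forall_ne {f : ℝ → ℝ} (hf : Continuous f) {a b c : ℝ} (hab : a ≤ b) (ha : c < f a)
    (h : ∀ s ∈ Icc a b, f s ≠ c) : c < f b := by
  by_contra! hle
  obtain ⟨s, hs, hEq⟩ := intermediate_value_Icc' hab hf.continuousOn ⟨hle, ha.le⟩
  exact h s hs hEq

/-- A lower bound on `(0, S]` passes to nearby members of a family that depends continuously on
the parameter, provided it holds near time `0` uniformly in the parameter. -/
lemma eventually_forall_lt {F : ℝ → ℝ → ℝ} {x₀ S c : ℝ} (hF : Continuous (F x₀))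
    (hdep : ∀ ε > 0, ∀ᶠ x in 𝓝 x₀, ∀ t ∈ Icc 0 S, |F x t - F x₀ t| < ε)
    (hearly : ∃ δ > 0, ∀ᶠ x in 𝓝 x₀, ∀ t ∈ Ioc 0 δ, c < F x t)
    (hS : ∀ t ∈ Ioc 0 S, c < F x₀ t) : ∀ᶠ x in 𝓝 x₀, ∀ t ∈ Ioc 0 S, c < F x t := by
  obtain ⟨δ, hδ, hearly⟩ := hearly
  obtain ⟨ε, hε, hgap⟩ : ∃ ε > 0, ∀ t ∈ Icc δ S, c + ε ≤ F x₀ t := by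
    rcases lt_or_ge S δ with hlt | hle
    · exact ⟨1, one_pos, fun t ht => absurd (ht.1.trans ht.2) (not_le.2 hlt)⟩
    · obtain ⟨t₀, ht₀, hmin⟩ := isCompact_Icc.exists_isMinOn (nonempty_Icc.2 hle) hF.continuousOn
      exact ⟨F x₀ t₀ - c, sub_pos.2 (hS t₀ ⟨hδ.trans_le ht₀.1, ht₀.2⟩), fun t ht => by
        simpa using hmin ht⟩
  filter_upwards [hearly, hdep ε hε] with x h1 h2 t ht
  rcases le_or_gt t δ with hle | hlt
  · exact h1 t ⟨ht.1, hle⟩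
  · have := (abs_lt.1 (h2 t (Ioc_subset_Icc_self ht))).1
    linarith [hgap t ⟨hlt.le, ht.2⟩]

namespace IsShootingFamily

variable {g m₁ m₂ : ℕ} {Ξ Θ A : ℝ → ℝ → ℝ}

lemma shot (h : IsShootingFamily g m₁ m₂ Ξ Θ A) (hg : 0 < g) (hm₁ : 0 < m₁) (hm₂ : 0 < m₂)
    (x : ℝ) : Shot g m₁ m₂ (Ξ x) (Θ x) (A x) :=
  ⟨hg, hm₁, hm₂, (h x).1, (h x).2.2.1, (h x).2.2.2⟩

lemma expXi_zero (h : IsShootingFamily g m₁ m₂ Ξ Θ A) (x : ℝ) :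
    expXi g (Ξ x) 0 = Real.exp (4 / (g : ℝ) * x) := by rw [expXi, (h x).2.1]

lemma tendsto_theta (h : IsShootingFamily g m₁ m₂ Ξ Θ A) (x₀ : ℝ) {t : ℝ} (ht : 0 ≤ t) :
    Tendsto (fun x => Θ x t) (𝓝 x₀) (𝓝 (Θ x₀ t)) :=
  Metric.tendsto_nhds.2 fun _ hε => (h.continuous_dependence x₀ t hε).mono fun _ hx =>
    (hx t ⟨ht, le_rfl⟩).1

lemma tendsto_alpha (h : IsShootingFamily g m₁ m₂ Ξ Θ A) (x₀ : ℝ) {t : ℝ} (ht : 0 ≤ t) :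
    Tendsto (fun x => A x t) (𝓝 x₀) (𝓝 (A x₀ t)) :=
  Metric.tendsto_nhds.2 fun _ hε => (h.continuous_dependence x₀ t hε).mono fun _ hx =>
    (hx t ⟨ht, le_rfl⟩).2

lemma exists_alpha_near (h : IsShootingFamily g m₁ m₂ Ξ Θ A) (x₀ : ℝ) :
    ∃ δ > 0, ∀ᶠ x in 𝓝 x₀, ∀ t ∈ Icc 0 δ, |A x t - Real.pi / 2| < 1 := by
  have hc := (h x₀).1.continuous_thd.tendsto 0
  rw [(h x₀).2.2.2] at hc
  obtain ⟨δ, hδ, hnear⟩ := Metric.eventually_nhds_iff.1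
    (Metric.tendsto_nhds.1 hc (1 / 2) (by norm_num))
  refine ⟨δ / 2, half_pos hδ, ?_⟩
  filter_upwards [h.continuous_dependence x₀ (δ / 2) (show (0 : ℝ) < 1 / 2 by norm_num)]
    with x hx t ht
  have h1 := (hx t ht).2
  have h2 := @hnear t (by rw [Real.dist_eq, sub_zero, abs_of_nonneg ht.1]; linarith [ht.2])
  rw [Real.dist_eq] at h2
  calc |A x t - Real.pi / 2| ≤ |A x t - A x₀ t| + |A x₀ t - Real.pi / 2| := abs_sub_le _ _ _
    _ < 1 := by linarith

lemma early_theta (h : IsShootingFamily g m₁ m₂ Ξ Θ A) (hg : 0 < g) (hm₁ : 0 < m₁)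
    (hm₂ : 0 < m₂) (x₀ : ℝ) :
    ∃ δ > 0, ∀ᶠ x in 𝓝 x₀, ∀ t ∈ Ioc 0 δ, thetaStar m₁ m₂ < Θ x t := by
  obtain ⟨δ, hδ, hA⟩ := h.exists_alpha_near x₀
  refine ⟨δ, hδ, hA.mono fun x hx t ht => ?_⟩
  have hs := h.shot hg hm₁ hm₂ x
  refine lt_of_hasDerivAt_pos_of_eq (fun t => (hs.sol t).2.1) hs.theta_zero.ge
    (fun r hr _ => mul_pos ?_ (hs.sin_two_pos r)) ht
  have := abs_lt.1 (hx r hr)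
  exact Real.sin_pos_of_pos_of_lt_pi (by linarith [Real.pi_gt_three])
    (by linarith [Real.pi_gt_three])

lemma early_alpha (h : IsShootingFamily g m₁ m₂ Ξ Θ A) (hg : 0 < g) (hm₁ : 0 < m₁)
    (hm₂ : 0 < m₂) {x₀ : ℝ} (hx₀ : mconst g m₁ m₂ < Real.exp (4 / (g : ℝ) * x₀)) :
    ∃ δ > 0, ∀ᶠ x in 𝓝 x₀, ∀ t ∈ Ioc 0 δ, A x t ∈ Ioo (Real.pi / 2) (3 * Real.pi / 2) := by
  obtain ⟨δ₁, hδ₁, hA⟩ := h.exists_alpha_near x₀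
  have hcont : Tendsto (fun d : ℝ => Real.exp (4 / (g : ℝ) * (x₀ - 2 * d))) (𝓝 0)
      (𝓝 (Real.exp (4 / (g : ℝ) * x₀))) := Continuous.tendsto' (by fun_prop) _ _ (by simp)
  obtain ⟨δ, hd, hδ, hδ'⟩ := (((hcont.mono_left nhdsWithin_le_nhds).eventually
    (lt_mem_nhds hx₀)).and (Ioo_mem_nhdsGT hδ₁)).exists
  refine ⟨δ, hδ, ?_⟩
  filter_upwards [hA, lt_mem_nhds (sub_lt_self x₀ hδ)] with x hx hxδ t ht
  have hs := h.shot hg hm₁ hm₂ x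
  have hup := abs_lt.1 (hx t ⟨ht.1.le, ht.2.trans hδ'.le⟩)
  refine ⟨lt_of_hasDerivAt_pos_of_eq (fun t => (hs.sol t).2.2) hs.alpha_zero.ge
    (fun r hr hEq => ?_) ht, by linarith [Real.pi_gt_three]⟩
  have hξ := abs_le.1 (IsSolution.abs_sub_le_of_bound (fun t => (hs.sol t).1) hr.1
    fun s _ => IsSolution.abs_fst_deriv_le (Θ x) (A x) s)
  rw [(h x).2.1] at hξ
  have hlt : mconst g m₁ m₂ < Real.exp (4 / (g : ℝ) * Ξ x r) := by
    refine hd.trans_le (Real.exp_le_exp.2 (mul_le_mul_of_nonneg_left ?_ (by positivity)))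
    linarith [hξ.1, hr.2]
  rw [hEq]
  simpa using mul_pos (hs.sin_two_pos r) (sub_pos.2 hlt)

lemma eventually_theta_gt (h : IsShootingFamily g m₁ m₂ Ξ Θ A) (hg : 0 < g) (hm₁ : 0 < m₁)
    (hm₂ : 0 < m₂) {x₀ S : ℝ} (hS : ∀ t ∈ Ioc 0 S, thetaStar m₁ m₂ < Θ x₀ t) :
    ∀ᶠ x in 𝓝 x₀, ∀ t ∈ Ioc 0 S, thetaStar m₁ m₂ < Θ x t :=
  eventually_forall_lt (h x₀).1.continuous_snd
    (fun _ hε => (h.continuous_dependence x₀ S hε).mono fun _ hx t ht => (hx t ht).1)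
    (h.early_theta hg hm₁ hm₂ x₀) hS

lemma eventually_alpha_mem (h : IsShootingFamily g m₁ m₂ Ξ Θ A) (hg : 0 < g) (hm₁ : 0 < m₁)
    (hm₂ : 0 < m₂) {x₀ S : ℝ} (hx₀ : mconst g m₁ m₂ < Real.exp (4 / (g : ℝ) * x₀))
    (hS : ∀ t ∈ Ioc 0 S, A x₀ t ∈ Ioo (Real.pi / 2) (3 * Real.pi / 2)) :
    ∀ᶠ x in 𝓝 x₀, ∀ t ∈ Ioc 0 S, A x t ∈ Ioo (Real.pi / 2) (3 * Real.pi / 2) := by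
  obtain ⟨δ, hδ, hearly⟩ := h.early_alpha hg hm₁ hm₂ hx₀
  have h1 := eventually_forall_lt (F := A) (h x₀).1.continuous_thd
    (fun _ hε => (h.continuous_dependence x₀ S hε).mono fun _ hx t ht => (hx t ht).2)
    ⟨δ, hδ, hearly.mono fun x hx t ht => (hx t ht).1⟩ fun t ht => (hS t ht).1
  have h2 := eventually_forall_lt (F := fun x t => -A x t) (c := -(3 * Real.pi / 2))
    (h x₀).1.continuous_thd.neg
    (fun _ hε => (h.continuous_dependence x₀ S hε).mono fun _ hx t ht => by
      rw [← abs_neg]; convert (hx t ht).2 using 2; ring)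
    ⟨δ, hδ, hearly.mono fun x hx t ht => neg_lt_neg (hx t ht).2⟩
    fun t ht => neg_lt_neg (hS t ht).2
  filter_upwards [h1, h2] with x hx hx' t ht
  exact ⟨hx t ht, neg_lt_neg_iff.1 (hx' t ht)⟩

/-- A shot that does not stay in `θ > θ*` has a first return time to `θ*`. -/
lemma exists_first_return (h : IsShootingFamily g m₁ m₂ Ξ Θ A) (hg : 0 < g) (hm₁ : 0 < m₁)
    (hm₂ : 0 < m₂) {x b : ℝ} (hb : 0 < b) (hle : Θ x b ≤ thetaStar m₁ m₂) :
    ∃ T ∈ Ioc 0 b, Θ x T = thetaStar m₁ m₂ ∧ ∀ t ∈ Ioo 0 T, thetaStar m₁ m₂ < Θ x t := by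
  obtain ⟨δ, hδ, hearly⟩ := h.early_theta hg hm₁ hm₂ x
  have hearly := hearly.self_of_nhds
  have hδb : δ < b := by
    by_contra! hlt
    exact (hearly b ⟨hb, hlt⟩).not_ge hle
  have hc := (h x).1.continuous_snd
  have hne : (Icc δ b ∩ {t | Θ x t = thetaStar m₁ m₂}).Nonempty := by
    by_contra! hemp
    exact (lt_of_forall_ne hc hδb.le (hearly δ ⟨hδ, le_rfl⟩)
      fun s hs hEq => (hemp ▸ (⟨hs, hEq⟩ : s ∈ Icc δ b ∩ {t | Θ x t = thetaStar m₁ m₂}) :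
        s ∈ (∅ : Set ℝ))).not_ge hle
  obtain ⟨T, ⟨hT, hTEq⟩, hleast⟩ := (isCompact_Icc.inter_right
    (isClosed_eq hc continuous_const)).exists_isLeast hne
  refine ⟨T, ⟨hδ.trans_le hT.1, hT.2⟩, hTEq, fun t ht => ?_⟩
  rcases le_or_gt t δ with hle' | hlt
  · exact hearly t ⟨ht.1, hle'⟩
  · refine lt_of_forall_ne hc hlt.le (hearly δ ⟨hδ, le_rfl⟩) fun s hs hEq => ?_
    exact (hleast ⟨⟨hs.1, hs.2.trans (ht.2.le.trans hT.2)⟩, hEq⟩).not_gt (hs.2.trans_lt ht.2)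

lemma exists_excursion (h : IsShootingFamily g m₁ m₂ Ξ Θ A) (hg : 0 < g) (hm₁ : 0 < m₁)
    (hm₂ : 0 < m₂) {x : ℝ} (hx : mconst g m₁ m₂ < Real.exp (4 / (g : ℝ) * x))
    (hx1 : Type1 m₁ m₂ Ξ Θ A x) : ∃ T, Excursion g m₁ m₂ (Ξ x) (Θ x) (A x) T := by
  obtain ⟨T, hT, hTEq, hcos⟩ := hx1
  obtain ⟨T', hT', hT'Eq, hgt⟩ := h.exists_first_return hg hm₁ hm₂ hT hTEq.le
  obtain ⟨δ, hδ, hearly⟩ := h.early_alpha hg hm₁ hm₂ hx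
  have hearly := hearly.self_of_nhds
  refine ⟨T', h.shot hg hm₁ hm₂ x, hT'.1, hgt, fun t ht => ?_, hT'Eq⟩
  have hc := (h x).1.continuous_thd
  rcases le_or_gt t δ with hle | hlt
  · exact hearly t ⟨ht.1, hle⟩
  have hδ' := hearly δ ⟨hδ, le_rfl⟩
  have hcos' : ∀ s ∈ Icc δ t, Real.cos (A x s) ≠ 0 := fun s hs h0 =>
    hcos s ⟨hδ.trans_le hs.1, hs.2.trans_lt (ht.2.trans_le hT'.2)⟩ (by rw [h0, zero_mul])
  refine ⟨lt_of_forall_ne hc hlt.le hδ'.1 fun s hs hEq => hcos' s hs (by rw [hEq]; simp),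
    neg_lt_neg_iff.1 (lt_of_forall_ne hc.neg hlt.le (neg_lt_neg hδ'.2) fun s hs hEq =>
      hcos' s hs ?_)⟩
  rw [neg_inj.1 hEq, show 3 * Real.pi / 2 = Real.pi / 2 + Real.pi by ring, Real.cos_add_pi]
  simp

/-- The bounds valid along excursions pass to right limits of parameters of type 1. -/
lemma exists_bounds_of_right_limit (h : IsShootingFamily g m₁ m₂ Ξ Θ A) (hg : 0 < g)
    (hm₁ : 0 < m₁) (hm₂ : 0 < m₂) {x₀ : ℝ} (hx₀ : mconst g m₁ m₂ ≤ Real.exp (4 / (g : ℝ) * x₀))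
    (htype : ∀ x > x₀, Type1 m₁ m₂ Ξ Θ A x) :
    ∃ κ > 0, ∀ S, (∀ t ∈ Ioc 0 S, thetaStar m₁ m₂ < Θ x₀ t) → ∀ t ∈ Icc 0 S,
      A x₀ t ∈ Icc (Real.pi / 2) (3 * Real.pi / 2) ∧ κ ≤ Real.cos (Θ x₀ t) := by
  obtain ⟨κ, hκ, hbound⟩ := exists_cos_lower_bound hg hm₁ hm₂ (Real.exp (4 / (g : ℝ) * (x₀ + 1)))
  have hg' : (0 : ℝ) < 4 / (g : ℝ) := by positivity
  refine ⟨κ, hκ, fun S hS t ht => ?_⟩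
  have hev : ∀ᶠ x in 𝓝[>] x₀, A x t ∈ Icc (Real.pi / 2) (3 * Real.pi / 2) ∧
      κ ≤ Real.cos (Θ x t) := by
    filter_upwards [nhdsWithin_le_nhds (h.eventually_theta_gt hg hm₁ hm₂ hS),
      Ioo_mem_nhdsGT (lt_add_one x₀)] with x hx hx1
    have hmx : mconst g m₁ m₂ < Real.exp (4 / (g : ℝ) * x) :=
      hx₀.trans_lt (Real.exp_lt_exp.2 (mul_lt_mul_of_pos_left hx1.1 hg'))
    obtain ⟨T, hexc⟩ := h.exists_excursion hg hm₁ hm₂ hmx (htype x hx1.1)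
    have hST : S < T := by
      by_contra! hle
      exact (hx T ⟨hexc.pos, hle⟩).ne' hexc.theta_end
    have htT : t < T := ht.2.trans_lt hST
    refine ⟨?_, hbound _ _ _ T hexc ?_ t ⟨ht.1, htT.le⟩⟩
    · rcases ht.1.eq_or_lt with h0 | h0
      · rw [← h0, hexc.alpha_zero]
        exact ⟨le_rfl, by linarith [Real.pi_pos]⟩
      · exact Ioo_subset_Icc_self (hexc.alpha_mem t ⟨h0, htT⟩)
    · rw [h.expXi_zero]
      exact Real.exp_le_exp.2 (mul_le_mul_of_nonneg_left hx1.2.le hg'.le)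
  exact ⟨isClosed_Icc.mem_of_tendsto
      ((h.tendsto_alpha x₀ ht.1).mono_left nhdsWithin_le_nhds) (hev.mono fun _ hx => hx.1),
    ge_of_tendsto ((Real.continuous_cos.tendsto _).comp
      ((h.tendsto_theta x₀ ht.1).mono_left nhdsWithin_le_nhds)) (hev.mono fun _ hx => hx.2)⟩

lemma exists_le_thetaStar (h : IsShootingFamily g m₁ m₂ Ξ Θ A) (hg : 0 < g)
    (hm₁ : 0 < m₁) (hm₂ : 0 < m₂) {x₀ : ℝ} (hx₀ : mconst g m₁ m₂ ≤ Real.exp (4 / (g : ℝ) * x₀))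
    (htype : ∀ x > x₀, Type1 m₁ m₂ Ξ Θ A x) : ∃ t > 0, Θ x₀ t ≤ thetaStar m₁ m₂ := by
  by_contra! hgt
  obtain ⟨κ, hκ, hbound⟩ := h.exists_bounds_of_right_limit hg hm₁ hm₂ hx₀ htype
  have hb := fun t (ht : (0 : ℝ) ≤ t) =>
    hbound t (fun s hs => hgt s hs.1) t (right_mem_Icc.2 ht)
  exact TrappedShot.false ⟨h.shot hg hm₁ hm₂ x₀, hκ, hgt, fun t ht => (hb t ht).1,
    fun t ht => (hb t ht).2⟩

lemma alpha_eq_of_exp_eq (h : IsShootingFamily g m₁ m₂ Ξ Θ A) (hg : 0 < g)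
    (hm₁ : 0 < m₁) (hm₂ : 0 < m₂) {x : ℝ} (hx : Real.exp (4 / (g : ℝ) * x) = mconst g m₁ m₂)
    (t : ℝ) : A x t = Real.pi / 2 := by
  have hs := h.shot hg hm₁ hm₂ x
  rw [(hs.sol.eq_of_cos_eq_zero (T := 0) (hs.theta_mem 0) (by simp [hs.alpha_zero])
    (by rw [h.expXi_zero, hx]) t).2, hs.alpha_zero]

lemma le_exp_of_right_type1 (h : IsShootingFamily g m₁ m₂ Ξ Θ A) (hg : 0 < g)
    (hm₁ : 0 < m₁) (hm₂ : 0 < m₂) {x₀ : ℝ} (htype : ∀ x > x₀, Type1 m₁ m₂ Ξ Θ A x) :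
    mconst g m₁ m₂ ≤ Real.exp (4 / (g : ℝ) * x₀) := by
  by_contra! hlt
  have hg' : (0 : ℝ) < g := by exact_mod_cast hg
  have hm := mconst_pos hg m₁ m₂
  have hexp : Real.exp (4 / (g : ℝ) * (g / 4 * Real.log (mconst g m₁ m₂))) = mconst g m₁ m₂ := by
    rw [← mul_assoc, div_mul_div_cancel₀ hg'.ne', div_self four_ne_zero, one_mul,
      Real.exp_log hm]
  obtain ⟨T, hT, -, hcos⟩ := htype (g / 4 * Real.log (mconst g m₁ m₂)) (by
    rw [← hexp, Real.exp_lt_exp] at hlt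
    exact lt_of_mul_lt_mul_left hlt (by positivity))
  refine hcos (T / 2) ⟨by linarith, by linarith⟩ ?_
  rw [h.alpha_eq_of_exp_eq hg hm₁ hm₂ hexp]
  simp

lemma lt_exp_of_right_type1 (h : IsShootingFamily g m₁ m₂ Ξ Θ A) (hg : 0 < g)
    (hm₁ : 0 < m₁) (hm₂ : 0 < m₂) {x₀ : ℝ} (htype : ∀ x > x₀, Type1 m₁ m₂ Ξ Θ A x) :
    mconst g m₁ m₂ < Real.exp (4 / (g : ℝ) * x₀) := by
  have hle := h.le_exp_of_right_type1 hg hm₁ hm₂ htype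
  refine lt_of_le_of_ne hle fun hEq => ?_
  have hs := h.shot hg hm₁ hm₂ x₀
  obtain ⟨t, ht, hθ⟩ := h.exists_le_thetaStar hg hm₁ hm₂ hle htype
  refine hθ.not_gt (lt_of_hasDerivAt_pos_of_eq (fun t => (hs.sol t).2.1) hs.theta_zero.ge
    (fun r _ _ => ?_) (right_mem_Ioc.2 ht))
  rw [h.alpha_eq_of_exp_eq hg hm₁ hm₂ hEq.symm]
  simpa using hs.sin_two_pos r

/-- On `(0, T)` the angle `α` touches neither `π/2` nor `3π/2`. -/
lemma alpha_mem_Ioo (h : IsShootingFamily g m₁ m₂ Ξ Θ A) (hg : 0 < g)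
    (hm₁ : 0 < m₁) (hm₂ : 0 < m₂) {x T : ℝ} (hx : mconst g m₁ m₂ < Real.exp (4 / (g : ℝ) * x))
    (hA : ∀ t ∈ Ioo 0 T, A x t ∈ Icc (Real.pi / 2) (3 * Real.pi / 2)) {t : ℝ}
    (ht : t ∈ Ioo 0 T) : A x t ∈ Ioo (Real.pi / 2) (3 * Real.pi / 2) := by
  have hs := h.shot hg hm₁ hm₂ x
  have hnhds : Ioo 0 T ∈ 𝓝 t := Ioo_mem_nhds ht.1 ht.2
  have hfalse : Real.cos (A x t) = 0 → (IsLocalMin (A x) t ∨ IsLocalMax (A x) t) → False := by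
    intro hcos hloc
    have hd := hloc.elim (fun hl => hl.hasDerivAt_eq_zero (hs.sol t).2.2)
      (fun hl => hl.hasDerivAt_eq_zero (hs.sol t).2.2)
    rw [hcos, mul_zero, zero_mul, add_zero] at hd
    have hsin : Real.sin (A x t) ≠ 0 := fun h0 => by
      simpa [hcos, h0] using Real.sin_sq_add_cos_sq (A x t)
    have hE := (mul_eq_zero.1 hd).resolve_left (mul_ne_zero hsin (hs.sin_two_pos t).ne')
    have hEq := (hs.sol.eq_of_cos_eq_zero (hs.theta_mem t) hcos (sub_eq_zero.1 hE) 0).1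
    rw [(h x).2.1] at hEq
    rw [← hEq] at hE
    linarith
  refine ⟨lt_of_le_of_ne (hA t ht).1 fun hEq => hfalse (by rw [← hEq]; simp) (Or.inl ?_),
    lt_of_le_of_ne (hA t ht).2 fun hEq => hfalse ?_ (Or.inr ?_)⟩
  · filter_upwards [hnhds] with s hs
    rw [← hEq]
    exact (hA s hs).1
  · rw [hEq, show 3 * Real.pi / 2 = Real.pi / 2 + Real.pi by ring, Real.cos_add_pi]
    simp
  · filter_upwards [hnhds] with s hs
    rw [hEq]
    exact (hA s hs).2

/-- A transversal return to `θ*` with `α ∈ (π/2, 3π/2)` persists for nearby parameters. -/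
lemma eventually_type1 (h : IsShootingFamily g m₁ m₂ Ξ Θ A) (hg : 0 < g)
    (hm₁ : 0 < m₁) (hm₂ : 0 < m₂) {x₀ T : ℝ}
    (hx₀ : mconst g m₁ m₂ < Real.exp (4 / (g : ℝ) * x₀)) (hT : 0 < T)
    (hTEq : Θ x₀ T = thetaStar m₁ m₂) (hgt : ∀ t ∈ Ioo 0 T, thetaStar m₁ m₂ < Θ x₀ t)
    (hA : ∀ t ∈ Ioc 0 T, A x₀ t ∈ Ioo (Real.pi / 2) (3 * Real.pi / 2)) :
    ∀ᶠ x in 𝓝 x₀, Type1 m₁ m₂ Ξ Θ A x := by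
  have hs := h.shot hg hm₁ hm₂ x₀
  have hslope := hasDerivAt_iff_tendsto_slope.1 (hs.sol T).2.1
  have hsin : Real.sin (A x₀ T) ≠ 0 := fun h0 => by
    have := hs.sol.eq_of_sin_eq_zero hm₂ hTEq h0 0
    rw [← this, hs.alpha_zero] at h0
    simp at h0
  have hneg : Real.sin (A x₀ T) * Real.sin (2 * Θ x₀ T) < 0 := by
    refine lt_of_le_of_ne (le_of_not_gt fun hpos => ?_) (mul_ne_zero hsin (hs.sin_two_pos T).ne')
    obtain ⟨t, ht, ht'⟩ := (((hslope.mono_left (nhdsWithin_mono _ fun x hx => ne_of_lt hx) :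
      Tendsto _ (𝓝[<] T) _).eventually (lt_mem_nhds hpos)).and (Ioo_mem_nhdsLT hT)).exists
    rw [slope_def_field, hTEq] at ht
    exact ht.not_ge (div_nonpos_of_nonneg_of_nonpos (sub_nonneg.2 (hgt t ht').le)
      (sub_nonpos.2 ht'.2.le))
  obtain ⟨δ, hδ, hδA⟩ := Metric.mem_nhds_iff.1 (hs.sol.continuous_thd.continuousAt.preimage_mem_nhds
    (Ioo_mem_nhds (hA T (right_mem_Ioc.2 hT)).1 (hA T (right_mem_Ioc.2 hT)).2))
  obtain ⟨b, hb, hb'⟩ := (((hslope.mono_left (nhdsWithin_mono _ fun x hx => ne_of_gt hx) :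
      Tendsto _ (𝓝[>] T) _).eventually (gt_mem_nhds hneg)).and
      (Ioo_mem_nhdsGT (lt_add_of_pos_right T hδ))).exists
  have hbθ : Θ x₀ b < thetaStar m₁ m₂ := by
    rw [slope_def_field, hTEq, div_neg_iff] at hb
    rcases hb with hb | hb <;> linarith [hb.2, hb.1, hb'.1]
  have hAb : ∀ t ∈ Ioc 0 b, A x₀ t ∈ Ioo (Real.pi / 2) (3 * Real.pi / 2) := by
    intro t ht
    rcases le_or_gt t T with hle | hlt
    · exact hA t ⟨ht.1, hle⟩
    · refine hδA ?_
      rw [Metric.mem_ball, Real.dist_eq, abs_of_pos (sub_pos.2 hlt)]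
      linarith [ht.2, hb'.2]
  have hb0 : 0 < b := hT.trans hb'.1
  filter_upwards [h.eventually_alpha_mem hg hm₁ hm₂ hx₀ hAb,
    (h.tendsto_theta x₀ hb0.le).eventually (gt_mem_nhds hbθ)] with x hx1 hx2
  obtain ⟨T', hT', hT'Eq, -⟩ := h.exists_first_return hg hm₁ hm₂ hb0 hx2.le
  refine ⟨T', hT'.1, hT'Eq, fun t ht => mul_ne_zero (ne_of_lt ?_)
    ((h.shot hg hm₁ hm₂ x).sin_two_pos t).ne'⟩
  have := hx1 t ⟨ht.1, ht.2.le.trans hT'.2⟩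
  exact Real.cos_neg_of_pi_div_two_lt_of_lt this.1 (by linarith [this.2])

end IsShootingFamily

end

/-- Proposition 3.4: `ξ₀*` is both of type 1 and of type 2. -/
theorem stmt12 (g m₁ m₂ : ℕ) (hg : g = 1 ∨ g = 2 ∨ g = 3 ∨ g = 4 ∨ g = 6)
    (hm₁ : 0 < m₁) (hm₂ : 0 < m₂)
    (Ξ Θ A : ℝ → ℝ → ℝ) (hfam : IsShootingFamily g m₁ m₂ Ξ Θ A)
    (hne : {r : ℝ | ∀ ξ₀ > r, Type1 m₁ m₂ Ξ Θ A ξ₀}.Nonempty)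
    (hbdd : BddBelow {r : ℝ | ∀ ξ₀ > r, Type1 m₁ m₂ Ξ Θ A ξ₀}) :
    Type1 m₁ m₂ Ξ Θ A (xiStar m₁ m₂ Ξ Θ A) ∧
      Type2 m₁ m₂ Ξ Θ A (xiStar m₁ m₂ Ξ Θ A) := by
  have hg0 : 0 < g := by omega
  set x₀ := xiStar m₁ m₂ Ξ Θ A with hx₀
  have htype : ∀ x > x₀, Type1 m₁ m₂ Ξ Θ A x := fun x hx => by
    obtain ⟨r, hr, hrx⟩ := exists_lt_of_csInf_lt hne hx
    exact hr x hrx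
  have hlt := hfam.lt_exp_of_right_type1 hg0 hm₁ hm₂ htype
  obtain ⟨b, hb, hbθ⟩ := hfam.exists_le_thetaStar hg0 hm₁ hm₂ hlt.le htype
  obtain ⟨T, hT, hTEq, hgt⟩ := hfam.exists_first_return hg0 hm₁ hm₂ hb hbθ
  obtain ⟨κ, -, hbound⟩ := hfam.exists_bounds_of_right_limit hg0 hm₁ hm₂ hlt.le htype
  have hs := hfam.shot hg0 hm₁ hm₂ x₀
  have hAc : ∀ t ∈ Set.Ioo 0 T, A x₀ t ∈ Set.Icc (Real.pi / 2) (3 * Real.pi / 2) := fun t ht =>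
    (hbound t (fun s hs => hgt s ⟨hs.1, hs.2.trans_lt ht.2⟩) t (Set.right_mem_Icc.2 ht.1.le)).1
  have hAT : A x₀ T ∈ Set.Icc (Real.pi / 2) (3 * Real.pi / 2) := by
    have hcl : closure (Set.Ioo 0 T) ⊆ A x₀ ⁻¹' Set.Icc (Real.pi / 2) (3 * Real.pi / 2) :=
      closure_minimal hAc (isClosed_Icc.preimage hs.sol.continuous_thd)
    rw [closure_Ioo hT.1.ne] at hcl
    exact hcl (Set.right_mem_Icc.2 hT.1.le)
  have hAo : ∀ t ∈ Set.Ioo 0 T, A x₀ t ∈ Set.Ioo (Real.pi / 2) (3 * Real.pi / 2) := fun t ht =>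
    hfam.alpha_mem_Ioo hg0 hm₁ hm₂ hlt hAc ht
  refine ⟨⟨T, hT.1, hTEq, fun t ht => mul_ne_zero (ne_of_lt ?_) (hs.sin_two_pos t).ne'⟩,
    ⟨T, hT.1, ?_, fun t ht => (hgt t ht).ne'⟩⟩
  · exact Real.cos_neg_of_pi_div_two_lt_of_lt (hAo t ht).1 (by linarith [(hAo t ht).2])
  · by_contra hcos
    have hcos' : Real.cos (A x₀ T) ≠ 0 := left_ne_zero_of_mul hcos
    have hATo : A x₀ T ∈ Set.Ioo (Real.pi / 2) (3 * Real.pi / 2) := by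
      refine ⟨lt_of_le_of_ne hAT.1 fun hEq => hcos' (by rw [← hEq]; simp),
        lt_of_le_of_ne hAT.2 fun hEq => hcos' ?_⟩
      rw [hEq, show 3 * Real.pi / 2 = Real.pi / 2 + Real.pi by ring, Real.cos_add_pi]
      simp
    have hev := hfam.eventually_type1 hg0 hm₁ hm₂ hlt hT.1 hTEq hgt fun t ht => by
      rcases ht.2.eq_or_lt with rfl | hlt'
      · exact hATo
      · exact hAo t ⟨ht.1, hlt'⟩
    obtain ⟨η, hη, hball⟩ := Metric.eventually_nhds_iff.1 hev
    have hmem : x₀ - η / 2 ∈ {r : ℝ | ∀ ξ₀ > r, Type1 m₁ m₂ Ξ Θ A ξ₀} := fun x hx => by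
      rcases lt_or_ge x₀ x with hlt' | hle
      · exact htype x hlt'
      · refine hball ?_
        rw [Real.dist_eq, abs_of_nonpos (sub_nonpos.2 hle)]
        linarith
    have := csInf_le hbdd hmem
    change x₀ ≤ _ at this
    linarith
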